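/- arXiv:2202.13550 — 12 statements merged into one kernel-verified Lean document; each statement's English description precedes it below -/
import Mathlib

section
/- Let f ∈ K[z] be a nonconstant polynomial, a ∈ K and r > 0. Then the image of the closed disk D̄(a,r) under f is again a closed disk centered at f(a); precisely, f(D̄(a,r)) = D̄(f(a), s), where s = max_{1 ≤ i ≤ deg f} ‖c_i‖ · r^i and c_i are the Taylor coefficients of f at a. -/
open Polynomial Metric

/-- If all the points of `m` have norm greater than `r`, then the constant coefficient of
`∏ (X - α)` strictly dominates all the other coefficients on the disk of radius `r`. -/
theorem norm_coeff_prod_X_sub_C_mul_pow_lt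
    {K : Type*} [NormedField K] [IsUltrametricDist K] {r : ℝ} (hr : 0 < r)
    (m : Multiset K) (hm : ∀ α ∈ m, r < ‖α‖) :
    0 < ‖(m.map fun α => X - C α).prod.coeff 0‖ ∧
      ∀ i, ‖(m.map fun α => X - C α).prod.coeff (i + 1)‖ * r ^ (i + 1) <
        ‖(m.map fun α => X - C α).prod.coeff 0‖ := by
  induction m using Multiset.induction_on with
  | empty => simp [coeff_one]
  | cons α m ih =>
    obtain ⟨h0, h1⟩ := ih fun β hβ => hm β (Multiset.mem_cons_of_mem hβ)
    have hα : r < ‖α‖ := hm α (Multiset.mem_cons_self α m)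
    have hα0 : 0 < ‖α‖ := hr.trans hα
    rw [Multiset.map_cons, Multiset.prod_cons]
    set q := (m.map fun α => X - C α).prod
    have hle : ∀ i, ‖q.coeff i‖ * r ^ i ≤ ‖q.coeff 0‖
      | 0 => by simp
      | i + 1 => (h1 i).le
    have hc0 : ‖((X - C α) * q).coeff 0‖ = ‖α‖ * ‖q.coeff 0‖ := by
      simp [sub_mul]
    refine ⟨by rw [hc0]; positivity, fun i => ?_⟩
    have hc : ((X - C α) * q).coeff (i + 1) = q.coeff i + -α * q.coeff (i + 1) := by
      rw [sub_mul, coeff_sub, coeff_X_mul, coeff_C_mul]; ring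
    rw [hc0, hc]
    refine (mul_le_mul_of_nonneg_right (IsUltrametricDist.norm_add_le_max _ _) (by positivity)).trans_lt ?_
    rw [max_mul_of_nonneg _ _ (by positivity)]
    refine max_lt ?_ ?_
    · calc ‖q.coeff i‖ * r ^ (i + 1) = r * (‖q.coeff i‖ * r ^ i) := by ring
        _ ≤ r * ‖q.coeff 0‖ := by gcongr; exact hle i
        _ < ‖α‖ * ‖q.coeff 0‖ := by gcongr
    · rw [norm_mul, norm_neg, mul_assoc]
      exact mul_lt_mul_of_pos_left (h1 i) hα0

/-- A polynomial over an algebraically closed nonarchimedean field, one of whose nonconstant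
coefficients dominates the constant one on the disk of radius `r`, has a root in that disk. -/
theorem exists_isRoot_norm_le
    {K : Type*} [NormedField K] [IsUltrametricDist K] [IsAlgClosed K] {r : ℝ} (hr : 0 < r)
    (p : K[X]) (hp : p ≠ 0) (i : ℕ) (hi : ‖p.coeff 0‖ ≤ ‖p.coeff (i + 1)‖ * r ^ (i + 1)) :
    ∃ w, ‖w‖ ≤ r ∧ p.eval w = 0 := by
  by_contra! h
  have hm : ∀ α ∈ p.roots, r < ‖α‖ := fun α hα =>
    lt_of_not_ge fun hle => h α hle ((mem_roots hp).1 hα)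
  have hlt := (norm_coeff_prod_X_sub_C_mul_pow_lt hr p.roots hm).2 i
  have hc : 0 < ‖p.leadingCoeff‖ := norm_pos_iff.2 (leadingCoeff_ne_zero.2 hp)
  refine hi.not_gt ?_
  rw [(IsAlgClosed.splits p).eq_prod_roots, coeff_C_mul, coeff_C_mul, norm_mul, norm_mul, mul_assoc]
  exact mul_lt_mul_of_pos_left hlt hc

/-- The image of a closed disk under a nonconstant polynomial over an algebraically closed,
complete nonarchimedean field is a closed disk centered at the image of the center, of radius
`max_{1 ≤ i ≤ deg f} ‖c_i‖ r^i` where `c_i` are the Taylor coefficients of `f` at the center. -/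
theorem image_closedBall_eq_closedBall
    {K : Type*} [NontriviallyNormedField K] [IsUltrametricDist K]
    [IsAlgClosed K] [CharZero K] [CompleteSpace K]
    (f : Polynomial K) (hf : 0 < f.natDegree) (a : K) (r : ℝ) (hr : 0 < r) :
    (fun z => f.eval z) '' closedBall a r =
      closedBall (f.eval a)
        ((Finset.Icc 1 f.natDegree).sup' (Finset.nonempty_Icc.mpr hf)
          (fun i => ‖(Polynomial.taylor a f).coeff i‖ * r ^ i)) := by
  set g := taylor a f with hg
  have hdeg : g.natDegree = f.natDegree := natDegree_taylor f a
  have hg0 : g.coeff 0 = f.eval a := taylor_coeff_zero a f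
  have heval : ∀ w, g.eval w = f.eval (w + a) := fun w => taylor_eval a f w
  ext b
  simp only [Set.mem_image, mem_closedBall, dist_eq_norm]
  constructor
  · rintro ⟨z, hz, rfl⟩
    have hsum : f.eval z - f.eval a =
        ∑ i ∈ Finset.range f.natDegree, g.coeff (i + 1) * (z - a) ^ (i + 1) := by
      have h := heval (z - a)
      rw [sub_add_cancel, eval_eq_sum_range, hdeg, Finset.sum_range_succ', hg0] at h
      rw [← h]
      simp
    rw [hsum]
    refine IsUltrametricDist.norm_sum_le_of_forall_le_of_nonneg ?_ fun i hi => ?_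
    · exact (by positivity : (0 : ℝ) ≤ ‖g.coeff 1‖ * r ^ 1).trans
        (Finset.le_sup' (fun i => ‖g.coeff i‖ * r ^ i) (Finset.mem_Icc.2 ⟨le_rfl, hf⟩))
    · have hi' : i + 1 ∈ Finset.Icc 1 f.natDegree :=
        Finset.mem_Icc.2 ⟨by omega, Finset.mem_range.1 hi⟩
      refine le_trans ?_ (Finset.le_sup' (fun i => ‖g.coeff i‖ * r ^ i) hi')
      rw [norm_mul, norm_pow]
      gcongr
  · intro hb
    obtain ⟨j, hj, hsup⟩ := Finset.exists_mem_eq_sup' (Finset.nonempty_Icc.mpr hf)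
      (fun i => ‖g.coeff i‖ * r ^ i)
    rw [hsup] at hb
    obtain ⟨i, rfl⟩ : ∃ i, j = i + 1 := Nat.exists_eq_add_of_le' (Finset.mem_Icc.1 hj).1
    have hp : g - C b ≠ 0 := by
      intro h
      have := natDegree_sub_C (p := g) (a := b)
      rw [h, natDegree_zero] at this
      omega
    obtain ⟨w, hw, hroot⟩ := exists_isRoot_norm_le hr (g - C b) hp i (by
      rw [coeff_sub, coeff_sub, coeff_C_zero, coeff_C_succ, sub_zero, hg0, norm_sub_rev]
      exact hb)
    refine ⟨w + a, by simpa using hw, ?_⟩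
    rw [← heval]
    simpa [sub_eq_zero] using hroot
end

section
/- Let f ∈ K[z] be a nonconstant polynomial, a ∈ K and r > 0. Then the image of the open disk D(a,r) under f is again an open disk centered at f(a); precisely, f(D(a,r)) = D(f(a), s), where s = max_{1 ≤ i ≤ deg f} ‖c_i‖ · r^i and c_i are the Taylor coefficients of f at a. -/
open Polynomial Metric

/-- If two polynomials have all their Gauss terms of radius `r` bounded by their constant terms,
then so does their product. -/
theorem norm_coeff_mul_le_of_forall_le
    {K : Type*} [NormedField K] [IsUltrametricDist K] {p q : Polynomial K} {r : ℝ} (hr : 0 < r)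
    (hp : ∀ i, ‖p.coeff i‖ * r ^ i ≤ ‖p.coeff 0‖) (hq : ∀ i, ‖q.coeff i‖ * r ^ i ≤ ‖q.coeff 0‖)
    (n : ℕ) : ‖(p * q).coeff n‖ * r ^ n ≤ ‖(p * q).coeff 0‖ := by
  rw [← le_div_iff₀ (pow_pos hr n), coeff_mul]
  refine IsUltrametricDist.norm_sum_le_of_forall_le_of_nonneg (by positivity) ?_
  rintro ⟨i, j⟩ hij
  rw [Finset.HasAntidiagonal.mem_antidiagonal] at hij
  subst hij
  rw [le_div_iff₀ (by positivity), mul_coeff_zero, norm_mul, norm_mul, pow_add]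
  calc ‖p.coeff i‖ * ‖q.coeff j‖ * (r ^ i * r ^ j)
      = (‖p.coeff i‖ * r ^ i) * (‖q.coeff j‖ * r ^ j) := by ring
    _ ≤ ‖p.coeff 0‖ * ‖q.coeff 0‖ :=
      mul_le_mul (hp i) (hq j) (by positivity) (norm_nonneg _)

/-- If a split polynomial has no root in the open disk of radius `r` around `0`, then its
constant term dominates all its Gauss terms of radius `r`. -/
theorem Polynomial.Splits.norm_coeff_mul_pow_le
    {K : Type*} [NormedField K] [IsUltrametricDist K] {g : Polynomial K} (hg : g.Splits)
    {r : ℝ} (hr : 0 < r) (hroots : ∀ b ∈ g.roots, r ≤ ‖b‖) (n : ℕ) :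
    ‖g.coeff n‖ * r ^ n ≤ ‖g.coeff 0‖ := by
  have hC (c : K) (i : ℕ) : ‖(C c).coeff i‖ * r ^ i ≤ ‖(C c).coeff 0‖ := by
    rcases i with _ | i <;> simp [coeff_C]
  have hprod (s : Multiset K) (hs : ∀ b ∈ s, r ≤ ‖b‖) (i : ℕ) :
      ‖(s.map (X - C ·)).prod.coeff i‖ * r ^ i ≤ ‖(s.map (X - C ·)).prod.coeff 0‖ := by
    induction s using Multiset.induction_on generalizing i with
    | empty => simpa using hC 1 i
    | cons b s ih =>
      rw [Multiset.map_cons, Multiset.prod_cons]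
      refine norm_coeff_mul_le_of_forall_le hr ?_
        (ih fun c hc => hs c (Multiset.mem_cons_of_mem hc)) i
      have hb := hs b (Multiset.mem_cons_self b s)
      rintro (_ | _ | j)
      · simp
      · simpa using hb
      · simp [coeff_X, coeff_C]
  rw [hg.eq_prod_roots]
  exact norm_coeff_mul_le_of_forall_le hr (hC _) (hprod _ hroots) n

/-- The image of an open disk under a nonconstant polynomial over an algebraically closed,
complete nonarchimedean field is an open disk centered at the image of the center, of radius
`max_{1 ≤ i ≤ deg f} ‖c_i‖ r^i` where `c_i` are the Taylor coefficients of `f` at the center. -/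
theorem image_ball_eq_ball
    {K : Type*} [NontriviallyNormedField K] [IsUltrametricDist K]
    [IsAlgClosed K] [CharZero K] [CompleteSpace K]
    (f : Polynomial K) (hf : 0 < f.natDegree) (a : K) (r : ℝ) (hr : 0 < r) :
    (fun z => f.eval z) '' ball a r =
      ball (f.eval a)
        ((Finset.Icc 1 f.natDegree).sup' (Finset.nonempty_Icc.mpr hf)
          (fun i => ‖(Polynomial.taylor a f).coeff i‖ * r ^ i)) := by
  set s := (Finset.Icc 1 f.natDegree).sup' (Finset.nonempty_Icc.mpr hf)
    (fun i => ‖(Polynomial.taylor a f).coeff i‖ * r ^ i)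
  have hle (i : ℕ) (hi : i ∈ Finset.Icc 1 f.natDegree) :
      ‖(Polynomial.taylor a f).coeff i‖ * r ^ i ≤ s :=
    Finset.le_sup' (fun i => ‖(Polynomial.taylor a f).coeff i‖ * r ^ i) hi
  have hs : 0 < s := by
    refine lt_of_lt_of_le ?_ (hle f.natDegree (Finset.mem_Icc.mpr ⟨hf, le_rfl⟩))
    have hlead : (taylor a f).coeff f.natDegree ≠ 0 := by
      rw [← natDegree_taylor f a, coeff_natDegree, leadingCoeff_ne_zero]
      exact ne_zero_of_natDegree_gt (n := 0) (by rwa [natDegree_taylor])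
    have := norm_pos_iff.mpr hlead
    positivity
  ext w
  simp only [Set.mem_image, mem_ball, dist_eq_norm]
  constructor
  · rintro ⟨z, hz, rfl⟩
    have hexp : f.eval z - f.eval a =
        ∑ i ∈ Finset.Icc 1 f.natDegree, (taylor a f).coeff i * (z - a) ^ i := by
      rw [← taylor_eval_sub a f z, eval_eq_sum_range, natDegree_taylor, Finset.range_eq_Ico,
        Finset.sum_eq_sum_Ico_succ_bot (Nat.succ_pos _), taylor_coeff_zero, pow_zero, mul_one,
        add_sub_cancel_left]
      rfl
    obtain ⟨i, hi, hnorm⟩ := IsUltrametricDist.exists_norm_finsetSum_le_of_nonempty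
      (Finset.nonempty_Icc.mpr hf) (fun i => (taylor a f).coeff i * (z - a) ^ i)
    rw [hexp]
    refine hnorm.trans_lt ?_
    rw [norm_mul, norm_pow]
    rcases eq_or_ne ((taylor a f).coeff i) 0 with h0 | h0
    · simpa [h0] using hs
    · refine lt_of_lt_of_le ?_ (hle i hi)
      have hi0 : i ≠ 0 := Nat.one_le_iff_ne_zero.mp (Finset.mem_Icc.mp hi).1
      exact mul_lt_mul_of_pos_left (pow_lt_pow_left₀ hz (norm_nonneg _) hi0)
        (norm_pos_iff.mpr h0)
  · intro hw
    by_contra! hno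
    obtain ⟨i, hi, hmax⟩ := Finset.exists_mem_eq_sup' (Finset.nonempty_Icc.mpr hf)
      (fun i => ‖(Polynomial.taylor a f).coeff i‖ * r ^ i)
    have hi0 : i ≠ 0 := Nat.one_le_iff_ne_zero.mp (Finset.mem_Icc.mp hi).1
    have key := (IsAlgClosed.splits (taylor a f - C w)).norm_coeff_mul_pow_le hr (fun b hb => by
      by_contra! hbr
      have hroot : (taylor a f - C w).eval b = 0 := (mem_roots'.mp hb).2
      rw [eval_sub, eval_C, taylor_eval, sub_eq_zero] at hroot
      exact hno (b + a) (by simpa using hbr) hroot) i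
    rw [coeff_sub, coeff_sub, coeff_C_of_ne_zero hi0, sub_zero, coeff_C_zero, taylor_coeff_zero,
      norm_sub_rev] at key
    exact absurd (hmax.le.trans key) (not_le.mpr hw)
end

section
/- Let f ∈ K[z] be a nonconstant polynomial, b ∈ K, s > 0, and let a ∈ K satisfy f(a) ∈ D(b,s). Then there exists r > 0 such that f(D(a,r)) = D(b,s). (The 'component' of the preimage of an open disk containing a given preimage point is an open disk mapped onto that disk.) -/
open Polynomial Metric

/-- Multiplying linear factors whose roots have norm at least `r` keeps the constant
coefficient dominant on the disk of radius `r`. -/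
theorem norm_coeff_mul_pow_le_of_roots {K : Type*} [NormedField K] [IsUltrametricDist K]
    {r : ℝ} (hr : 0 < r) (c : K) (m : Multiset K) (hm : ∀ x ∈ m, r ≤ ‖x‖) (i : ℕ) :
    ‖(C c * (m.map fun x => X - C x).prod).coeff i‖ * r ^ i ≤
      ‖(C c * (m.map fun x => X - C x).prod).coeff 0‖ := by
  induction m using Multiset.induction_on generalizing i with
  | empty => cases i <;> simp [coeff_C]
  | cons x m ih =>
    have ih' := ih fun y hy => hm y (Multiset.mem_cons_of_mem hy)
    have hx : r ≤ ‖x‖ := hm x (Multiset.mem_cons_self x m)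
    rw [Multiset.map_cons, Multiset.prod_cons, mul_left_comm]
    generalize C c * (m.map fun x => X - C x).prod = p at ih'
    cases i with
    | zero => simp
    | succ i =>
      have h0 : ‖((X - C x) * p).coeff 0‖ = ‖x‖ * ‖p.coeff 0‖ := by
        simp [mul_coeff_zero]
      have h1 : ((X - C x) * p).coeff (i + 1) = p.coeff i + -(x * p.coeff (i + 1)) := by
        rw [sub_mul, coeff_sub, coeff_X_mul, coeff_C_mul, sub_eq_add_neg]
      rw [h0, h1]
      have hA : ‖p.coeff i‖ * r ^ (i + 1) ≤ ‖x‖ * ‖p.coeff 0‖ := by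
        calc ‖p.coeff i‖ * r ^ (i + 1) = r * (‖p.coeff i‖ * r ^ i) := by ring
          _ ≤ _ := mul_le_mul hx (ih' i) (by positivity) (by positivity)
      have hB : ‖-(x * p.coeff (i + 1))‖ * r ^ (i + 1) ≤ ‖x‖ * ‖p.coeff 0‖ := by
        rw [norm_neg, norm_mul, mul_assoc]
        exact mul_le_mul_of_nonneg_left (ih' (i + 1)) (norm_nonneg x)
      rcases le_max_iff.1 (IsUltrametricDist.norm_add_le_max (p.coeff i) (-(x * p.coeff (i + 1))))
        with h | h
      · exact (mul_le_mul_of_nonneg_right h (by positivity)).trans hA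
      · exact (mul_le_mul_of_nonneg_right h (by positivity)).trans hB

/-- Some coefficient of positive index violating `‖p_i‖ r ^ i ≤ ‖p_0‖` forces a root in the
open disk of radius `r` about `0`. -/
theorem exists_root_norm_lt {K : Type*} [NormedField K] [IsUltrametricDist K] [IsAlgClosed K]
    {p : K[X]} {r : ℝ} (hr : 0 < r) {i : ℕ} (hi : ‖p.coeff 0‖ < ‖p.coeff i‖ * r ^ i) :
    ∃ z : K, ‖z‖ < r ∧ p.eval z = 0 := by
  by_contra! h
  have key := norm_coeff_mul_pow_le_of_roots hr p.leadingCoeff p.roots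
    (fun x hx => not_lt.1 fun hlt => h x hlt (isRoot_of_mem_roots hx)) i
  rw [← (IsAlgClosed.splits p).eq_prod_roots] at key
  exact key.not_gt hi

/-- For a nonconstant polynomial, the Gauss norm of its nonconstant part takes every positive
value `s` at some radius `r`. -/
theorem exists_radius_norm_coeff_mul_pow {K : Type*} [NormedField K] {p : K[X]}
    (hp : 0 < p.natDegree) {s : ℝ} (hs : 0 < s) :
    ∃ r : ℝ, 0 < r ∧ (∀ i ≠ 0, ‖p.coeff i‖ * r ^ i ≤ s) ∧ ∃ i ≠ 0, ‖p.coeff i‖ * r ^ i = s := by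
  have hp0 : p ≠ 0 := by rintro rfl; simp at hp
  let ρ : ℕ → ℝ := fun i => (s / ‖p.coeff i‖) ^ ((i : ℝ)⁻¹)
  have hρ : ∀ i ≠ 0, p.coeff i ≠ 0 → 0 < ρ i ∧ ρ i ^ i = s / ‖p.coeff i‖ := fun i hi hc =>
    have hpos : 0 < s / ‖p.coeff i‖ := div_pos hs (norm_pos_iff.2 hc)
    ⟨Real.rpow_pos_of_pos hpos _, Real.rpow_inv_natCast_pow hpos.le hi⟩
  obtain ⟨i, hi, hmin⟩ := (p.support.erase 0).exists_min_image ρ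
    ⟨p.natDegree, Finset.mem_erase.2 ⟨hp.ne', natDegree_mem_support_of_nonzero hp0⟩⟩
  obtain ⟨hi0, hic⟩ := Finset.mem_erase.1 hi
  obtain ⟨hpos, hpow⟩ := hρ i hi0 (mem_support_iff.1 hic)
  refine ⟨ρ i, hpos, fun j hj => ?_, i, hi0, ?_⟩
  · by_cases hc : p.coeff j = 0
    · simp [hc, hs.le]
    · have hle := hmin j (Finset.mem_erase.2 ⟨hj, mem_support_iff.2 hc⟩)
      have hlt : ρ i ^ j ≤ s / ‖p.coeff j‖ :=
        (pow_le_pow_left₀ hpos.le hle j).trans_eq (hρ j hj hc).2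
      rwa [le_div_iff₀ (norm_pos_iff.2 hc), mul_comm] at hlt
  · rw [hpow, mul_div_cancel₀ _ (norm_ne_zero_iff.2 (mem_support_iff.1 hic))]

/-- If all nonconstant terms of `p` are bounded by `s` at radius `r`, then `p` maps the open
disk of radius `r` about `0` into the open disk of radius `s` about `p 0`. -/
theorem norm_eval_sub_coeff_zero_lt {K : Type*} [NormedField K] [IsUltrametricDist K]
    {p : K[X]} {r s : ℝ} (hs : 0 < s) (h : ∀ i ≠ 0, ‖p.coeff i‖ * r ^ i ≤ s)
    {z : K} (hz : ‖z‖ < r) : ‖p.eval z - p.coeff 0‖ < s := by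
  rw [eval_eq_sum_range, Finset.sum_range_succ', pow_zero, mul_one, add_sub_cancel_right]
  refine Finset.sum_induction _ (fun x : K => ‖x‖ < s)
    (fun x y hx hy => (IsUltrametricDist.norm_add_le_max x y).trans_lt (max_lt hx hy))
    (by simpa using hs) fun i _ => ?_
  rw [norm_mul, norm_pow]
  rcases (norm_nonneg (p.coeff (i + 1))).eq_or_lt with hc | hc
  · simpa [← hc] using hs
  · exact (mul_lt_mul_of_pos_left (pow_lt_pow_left₀ hz (norm_nonneg z) i.succ_ne_zero) hc).trans_le
      (h (i + 1) i.succ_ne_zero)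

/-- If `f` is a nonconstant polynomial over an algebraically closed, complete nonarchimedean
field and `f(a)` lies in the open disk `D(b,s)`, then some open disk centered at `a` is mapped
by `f` onto `D(b,s)`: the component of the preimage of an open disk containing a given
preimage point is an open disk mapped onto that disk. -/
theorem exists_ball_image_eq_ball
    {K : Type*} [NontriviallyNormedField K] [IsUltrametricDist K]
    [IsAlgClosed K] [CharZero K] [CompleteSpace K]
    (f : Polynomial K) (hf : 0 < f.natDegree) (b : K) (s : ℝ) (hs : 0 < s)
    (a : K) (ha : f.eval a ∈ ball b s) :
    ∃ r : ℝ, 0 < r ∧ (fun z => f.eval z) '' ball a r = ball b s := by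
  have hg : 0 < (taylor a f).natDegree := by rwa [natDegree_taylor]
  obtain ⟨r, hr, hle, i, hi, heq⟩ := exists_radius_norm_coeff_mul_pow hg hs
  refine ⟨r, hr, ?_⟩
  rw [IsUltrametricDist.ball_eq_of_mem ha]
  ext w
  constructor
  · rintro ⟨z, hz, rfl⟩
    have := norm_eval_sub_coeff_zero_lt hs hle (mem_ball_iff_norm.1 hz)
    rw [taylor_eval, taylor_coeff_zero, sub_add_cancel] at this
    exact mem_ball_iff_norm.2 this
  · intro hw
    obtain ⟨z, hz, hroot⟩ := exists_root_norm_lt (p := taylor a f - C w) (i := i) hr (by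
      rw [coeff_sub, coeff_sub, coeff_C_zero, coeff_C_of_ne_zero hi, sub_zero, heq,
        taylor_coeff_zero]
      exact mem_ball_iff_norm'.1 hw)
    rw [eval_sub, eval_C, taylor_eval, sub_eq_zero] at hroot
    exact ⟨z + a, by simpa [mem_ball_iff_norm] using hz, hroot⟩
end

section
/- Let f ∈ K[z] be a nonconstant polynomial of degree d, b ∈ K and s > 0. Then there exist a finite set A ⊆ K with 1 ≤ #A ≤ d and radii r_a > 0 (a ∈ A) such that the open disks D(a, r_a), a ∈ A, are pairwise disjoint, their union equals the full preimage f⁻¹(D(b,s)), and f(D(a, r_a)) = D(b,s) for every a ∈ A. (The preimage of an open disk under a polynomial is a disjoint union of at most d open disks, each mapped onto the disk.) -/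
open Polynomial Metric

section DenseNorm

/-- The norms of an algebraically closed nontrivially normed field are dense in the
nonnegative reals. -/
theorem exists_norm_mem_Ioo_of_isAlgClosed (K : Type*) [NontriviallyNormedField K] [IsAlgClosed K]
    {x y : ℝ} (hxy : x < y) (hy : 0 < y) : ∃ z : K, ‖z‖ ∈ Set.Ioo x y := by
  obtain ⟨x', hx', hx'y⟩ := exists_between (max_lt hxy hy)
  have hx'0 : 0 < x' := (le_max_right _ _).trans_lt hx'
  obtain ⟨p, hp⟩ := NormedField.exists_one_lt_norm K
  obtain ⟨n, hn⟩ := pow_unbounded_of_one_lt ‖p‖ ((one_lt_div hx'0).2 hx'y)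
  have hn0 : n ≠ 0 := by
    rintro rfl
    exact absurd hn (by simpa using hp.le)
  obtain ⟨u, rfl⟩ := IsAlgClosed.exists_pow_nat_eq p (Nat.pos_of_ne_zero hn0)
  rw [norm_pow] at hp hn
  have hu1 : 1 < ‖u‖ := (one_lt_pow_iff_of_nonneg (norm_nonneg _) hn0).1 hp
  have hu2 : ‖u‖ < y / x' := lt_of_pow_lt_pow_left₀ n (by positivity) hn
  obtain ⟨k, hk1, hk2⟩ := exists_mem_Ico_zpow hx'0 hu1
  refine ⟨u ^ (k + 1), ?_, ?_⟩
  · rw [norm_zpow]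
    exact ((le_max_left _ _).trans_lt hx').trans hk2
  · rw [norm_zpow, zpow_add_one₀ (by positivity)]
    calc ‖u‖ ^ k * ‖u‖ ≤ x' * ‖u‖ := by gcongr
      _ < x' * (y / x') := by gcongr
      _ = y := by field_simp

/-- An open interval with positive right end contains a norm outside any given finite set. -/
theorem exists_norm_mem_Ioo_notMem (K : Type*) [NontriviallyNormedField K] [IsAlgClosed K]
    {x y : ℝ} (hxy : x < y) (hy : 0 < y) {F : Set ℝ} (hF : F.Finite) :
    ∃ z : K, ‖z‖ ∈ Set.Ioo x y ∧ ‖z‖ ∉ F := by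
  obtain ⟨x', hx', hx'y⟩ : ∃ x' < y, ∀ t ∈ insert x F, t < y → t ≤ x' := by
    have hfin : ((insert x F) ∩ Set.Iio y).Finite := (hF.insert x).inter_of_left _
    obtain ⟨m, hm, hmax⟩ := Set.exists_max_image _ id hfin ⟨x, Set.mem_insert _ _, hxy⟩
    exact ⟨m, hm.2, fun t ht hty => hmax t ⟨ht, hty⟩⟩
  obtain ⟨z, hz1, hz2⟩ := exists_norm_mem_Ioo_of_isAlgClosed K hx' hy
  exact ⟨z, ⟨(hx'y x (Set.mem_insert _ _) hxy).trans_lt hz1, hz2⟩, fun hz =>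
    (hx'y _ (Set.mem_insert_of_mem _ hz) hz2).not_gt hz1⟩

end DenseNorm

section DiskNorm

variable {K : Type*} [NontriviallyNormedField K]

/-- The generic (Gauss) absolute value of a split polynomial on the disk of centre `a` and
radius `r`, expressed through its roots. -/
noncomputable def diskNorm (g : Polynomial K) (a : K) (r : ℝ) : ℝ :=
  ‖g.leadingCoeff‖ * (g.roots.map fun x => max r ‖a - x‖).prod

theorem norm_eval_eq_of_splits {g : Polynomial K} (hg : g.Splits) (z : K) :
    ‖g.eval z‖ = ‖g.leadingCoeff‖ * (g.roots.map fun x => ‖z - x‖).prod := by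
  rw [hg.eval_eq_prod_roots, norm_mul]
  congr 1
  induction g.roots using Multiset.induction_on with
  | empty => simp
  | cons x m ih => simp [ih]

theorem continuous_diskNorm (g : Polynomial K) (a : K) : Continuous (diskNorm g a) := by
  unfold diskNorm
  exact continuous_const.mul
    (continuous_multiset_prod _ fun x _ => continuous_id.max continuous_const)

theorem diskNorm_zero {g : Polynomial K} {a : K} (ha : a ∈ g.roots) : diskNorm g a 0 = 0 := by
  rw [diskNorm, Multiset.prod_eq_zero, mul_zero]
  exact Multiset.mem_map.2 ⟨a, ha, by simp⟩

theorem strictMonoOn_diskNorm {g : Polynomial K} {a : K} (ha : a ∈ g.roots) :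
    StrictMonoOn (diskNorm g a) (Set.Ici 0) := by
  intro r hr r' _ hrr'
  rw [Set.mem_Ici] at hr
  have hr' : 0 < r' := hr.trans_lt hrr'
  have hg : 0 < ‖g.leadingCoeff‖ := by
    rw [norm_pos_iff, leadingCoeff_ne_zero]
    rintro rfl
    simp at ha
  obtain ⟨m, hm⟩ := Multiset.exists_cons_of_mem ha
  have hle : (m.map fun x => max r ‖a - x‖).prod ≤ (m.map fun x => max r' ‖a - x‖).prod :=
    Multiset.prod_map_le_prod_map₀ _ _ (fun x _ => hr.trans (le_max_left _ _))
      fun x _ => max_le_max_right _ hrr'.le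
  have hpos : 0 < (m.map fun x => max r' ‖a - x‖).prod := by
    refine Multiset.prod_induction (fun t : ℝ => 0 < t) _ (fun _ _ => mul_pos) one_pos ?_
    simp only [Multiset.mem_map]
    rintro _ ⟨x, -, rfl⟩
    exact lt_max_of_lt_left hr'
  simp only [diskNorm, hm, Multiset.map_cons, Multiset.prod_cons, sub_self, norm_zero,
    max_eq_left hr, max_eq_left hr'.le]
  refine mul_lt_mul_of_pos_left ?_ hg
  calc r * (m.map fun x => max r ‖a - x‖).prod
      ≤ r * (m.map fun x => max r' ‖a - x‖).prod := by gcongr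
    _ < r' * (m.map fun x => max r' ‖a - x‖).prod := by gcongr

theorem exists_diskNorm_eq {g : Polynomial K} {a : K} (ha : a ∈ g.roots) {s : ℝ} (hs : 0 ≤ s) :
    ∃ r, 0 ≤ r ∧ diskNorm g a r = s := by
  have hg : 0 < ‖g.leadingCoeff‖ := by
    rw [norm_pos_iff, leadingCoeff_ne_zero]
    rintro rfl
    simp at ha
  set R := max 1 (s / ‖g.leadingCoeff‖)
  have hR1 : 1 ≤ R := le_max_left _ _
  have hR0 : 0 ≤ R := zero_le_one.trans hR1
  have hR : s ≤ diskNorm g a R := by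
    have hcard : g.roots.card ≠ 0 := by
      intro h
      simp [Multiset.card_eq_zero.1 h] at ha
    calc s = ‖g.leadingCoeff‖ * (s / ‖g.leadingCoeff‖) := by field_simp
      _ ≤ ‖g.leadingCoeff‖ * R := by gcongr; exact le_max_right _ _
      _ ≤ ‖g.leadingCoeff‖ * R ^ g.roots.card := by gcongr; exact le_self_pow₀ hR1 hcard
      _ = ‖g.leadingCoeff‖ * (g.roots.map fun _ => R).prod := by simp
      _ ≤ diskNorm g a R := by
        unfold diskNorm
        gcongr
        exact Multiset.prod_map_le_prod_map₀ _ _ (fun x _ => hR0) fun x _ => le_max_left _ _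
  obtain ⟨r, hr, hrs⟩ := intermediate_value_Icc hR0 (continuous_diskNorm g a).continuousOn
    ⟨(diskNorm_zero ha).le.trans hs, hR⟩
  exact ⟨r, hr.1, hrs⟩

theorem norm_eval_eq_diskNorm {g : Polynomial K} (hg : g.Splits) {a z : K}
    (h : ∀ x ∈ g.roots, ‖z - x‖ = max ‖z - a‖ ‖a - x‖) :
    ‖g.eval z‖ = diskNorm g a ‖z - a‖ := by
  rw [norm_eval_eq_of_splits hg, diskNorm, Multiset.map_congr rfl h]

variable [IsUltrametricDist K]

theorem norm_sub_le_max_norm_sub (x y z : K) : ‖x - z‖ ≤ max ‖x - y‖ ‖y - z‖ := by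
  simpa [dist_eq_norm] using dist_triangle_max x y z

theorem norm_eval_le_diskNorm {g : Polynomial K} (hg : g.Splits) (a z : K) :
    ‖g.eval z‖ ≤ diskNorm g a ‖z - a‖ := by
  rw [norm_eval_eq_of_splits hg, diskNorm]
  gcongr
  exact Multiset.prod_map_le_prod_map₀ _ _ (fun x _ => norm_nonneg _)
    fun x _ => norm_sub_le_max_norm_sub z a x

theorem norm_eval_eq_diskNorm_of_nearest {g : Polynomial K} (hg : g.Splits) {a z : K}
    (h : ∀ x ∈ g.roots, ‖z - a‖ ≤ ‖z - x‖) : ‖g.eval z‖ = diskNorm g a ‖z - a‖ := by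
  refine norm_eval_eq_diskNorm hg fun x hx =>
    le_antisymm (norm_sub_le_max_norm_sub z a x) (max_le (h x hx) ?_)
  refine (norm_sub_le_max_norm_sub a z x).trans (max_le ?_ le_rfl)
  rw [norm_sub_rev]
  exact h x hx

theorem diskNorm_eq_of_norm_sub_le (g : Polynomial K) {a a' : K} {r : ℝ} (h : ‖a - a'‖ ≤ r) :
    diskNorm g a r = diskNorm g a' r := by
  rw [diskNorm, diskNorm]
  congr 3
  funext x
  apply le_antisymm
  · exact max_le (le_max_left _ _)
      ((norm_sub_le_max_norm_sub a a' x).trans (max_le_max_right _ h))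
  · rw [norm_sub_rev] at h
    exact max_le (le_max_left _ _)
      ((norm_sub_le_max_norm_sub a' a x).trans (max_le_max_right _ h))

theorem norm_eval_eq_of_forall_norm_sub_lt {g : Polynomial K} (hg : g.Splits) {a z : K}
    (h : ∀ x ∈ g.roots, ‖z - a‖ < ‖a - x‖) : ‖g.eval z‖ = ‖g.eval a‖ := by
  rw [norm_eval_eq_of_splits hg, norm_eval_eq_of_splits hg]
  congr 2
  refine Multiset.map_congr rfl fun x hx => ?_
  have := IsUltrametricDist.norm_add_eq_max_of_norm_ne_norm (h x hx).ne
  rwa [sub_add_sub_cancel, max_eq_right (h x hx).le] at this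

theorem ball_eq_ball_of_diskNorm_eq {g : Polynomial K} {a a' : K}
    (ha : a ∈ g.roots) (ha' : a' ∈ g.roots) {r r' : ℝ} (hr : 0 ≤ r) (hr' : 0 ≤ r')
    (heq : diskNorm g a r = diskNorm g a' r') (h : ¬ Disjoint (ball a r) (ball a' r')) :
    ball a r = ball a' r' := by
  wlog hle : r' ≤ r generalizing a a' r r'
  · exact (this ha' ha hr' hr heq.symm (fun h' => h h'.symm) (not_le.1 hle).le).symm
  obtain ⟨z, hz, hz'⟩ := Set.not_disjoint_iff.1 h
  have hd : dist a a' < r := (dist_triangle_max a z a').trans_lt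
    (max_lt (by rwa [dist_comm]) ((mem_ball.1 hz').trans_le hle))
  rw [diskNorm_eq_of_norm_sub_le g (by simpa [dist_eq_norm] using hd.le)] at heq
  obtain rfl := (strictMonoOn_diskNorm ha').injOn hr hr' heq
  exact IsUltrametricDist.ball_eq_of_mem (by rwa [mem_ball, dist_comm])

variable [IsAlgClosed K]

/-- A polynomial maps a disk around one of its roots onto the disk around `0` whose radius is
the Gauss norm. -/
theorem exists_mem_ball_eval_eq {g : Polynomial K} {a : K} (ha : a ∈ g.roots) {r : ℝ}
    (hr : 0 < r) {w : K} (hw : ‖w‖ < diskNorm g a r) : ∃ z ∈ ball a r, g.eval z = w := by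
  classical
  by_contra! hne
  obtain ⟨t, ht, htw⟩ := exists_diskNorm_eq ha (norm_nonneg w)
  have htr : t < r := by
    rw [← htw] at hw
    exact (strictMonoOn_diskNorm ha).lt_iff_lt ht hr.le |>.1 hw
  obtain ⟨y, ⟨hty, hyr⟩, hy⟩ := exists_norm_mem_Ioo_notMem K htr hr
    (F := (fun x => ‖a - x‖) '' (g.roots.toFinset : Set K))
    ((Finset.finite_toSet _).image _)
  have hgt : ‖w‖ < ‖g.eval (a + y)‖ := by
    rw [norm_eval_eq_diskNorm (IsAlgClosed.splits g) (a := a), add_sub_cancel_left, ← htw]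
    · exact strictMonoOn_diskNorm ha ht (norm_nonneg y) hty
    · intro x hx
      have hyx : ‖y‖ ≠ ‖a - x‖ := fun h => hy ⟨x, by simpa using hx, h.symm⟩
      rw [add_sub_cancel_left, ← IsUltrametricDist.norm_add_eq_max_of_norm_ne_norm hyx]
      congr 1
      ring
  have hconst : ‖(g - C w).eval (a + y)‖ = ‖(g - C w).eval a‖ := by
    refine norm_eval_eq_of_forall_norm_sub_lt (IsAlgClosed.splits _) fun x hx => ?_
    rw [add_sub_cancel_left]
    by_contra! hle
    refine hne x (by rw [mem_ball, dist_comm, dist_eq_norm]; exact hle.trans_lt hyr) ?_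
    simpa [sub_eq_zero] using (mem_roots'.1 hx).2
  have hga : g.eval a = 0 := (mem_roots'.1 ha).2
  rw [eval_sub, eval_sub, eval_C, eval_C, hga, zero_sub, norm_neg] at hconst
  have := norm_sub_le_max_norm_sub (g.eval (a + y)) w 0
  simp only [sub_zero, hconst, max_self] at this
  exact this.not_gt hgt

end DiskNorm

/-- The preimage of an open disk under a nonconstant polynomial of degree `d` over an
algebraically closed, complete nonarchimedean field is a disjoint union of at least one and
at most `d` open disks, each of which is mapped onto the disk. -/
theorem preimage_ball_eq_disjoint_union_balls
    {K : Type*} [NontriviallyNormedField K] [IsUltrametricDist K]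
    [IsAlgClosed K] [CharZero K] [CompleteSpace K]
    (f : Polynomial K) (hf : 0 < f.natDegree) (b : K) (s : ℝ) (hs : 0 < s) :
    ∃ (A : Finset K) (rad : K → ℝ),
      1 ≤ A.card ∧ A.card ≤ f.natDegree ∧
      (∀ a ∈ A, 0 < rad a) ∧
      (∀ a ∈ A, ∀ a' ∈ A, a ≠ a' → Disjoint (ball a (rad a)) (ball a' (rad a'))) ∧
      (⋃ a ∈ A, ball a (rad a)) = (fun z => f.eval z) ⁻¹' ball b s ∧
      (∀ a ∈ A, (fun z => f.eval z) '' ball a (rad a) = ball b s) := by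
  classical
  obtain ⟨g, hg⟩ : ∃ g, g = f - C b := ⟨_, rfl⟩
  have hdeg : g.natDegree = f.natDegree := by rw [hg, natDegree_sub_C]
  have heval (z : K) : g.eval z = f.eval z - b := by simp [hg]
  have hmem (z : K) : f.eval z ∈ ball b s ↔ ‖g.eval z‖ < s := by
    rw [mem_ball, dist_eq_norm, heval]
  have hsplits : g.Splits := IsAlgClosed.splits g
  have hcard : g.roots.card = f.natDegree := by rw [← hsplits.natDegree_eq_card_roots, hdeg]
  have hrad : ∀ a, ∃ r, a ∈ g.roots → 0 < r ∧ diskNorm g a r = s := by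
    intro a
    by_cases ha : a ∈ g.roots
    · obtain ⟨r, hr, hrs⟩ := exists_diskNorm_eq ha hs.le
      refine ⟨r, fun _ => ⟨hr.lt_of_ne ?_, hrs⟩⟩
      rintro rfl
      exact hs.ne ((diskNorm_zero ha).symm.trans hrs)
    · exact ⟨0, fun h => absurd h ha⟩
  choose rad hrad using hrad
  obtain ⟨A, hA, hinj, himage⟩ := Finset.exists_subset_injOn_image_eq_of_surjOn
    (f := fun a => ball a (rad a)) g.roots.toFinset
    (g.roots.toFinset.image fun a => ball a (rad a)) (by
      rw [Finset.coe_image]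
      exact Set.surjOn_image _ _)
  have hAr (a) (ha : a ∈ A) : a ∈ g.roots := Multiset.mem_toFinset.1 (hA ha)
  have hmaps (a) (ha : a ∈ A) (z) (hz : z ∈ ball a (rad a)) : f.eval z ∈ ball b s := by
    obtain ⟨hr, hrs⟩ := hrad a (hAr a ha)
    rw [hmem, ← hrs]
    rw [mem_ball, dist_eq_norm] at hz
    exact (norm_eval_le_diskNorm hsplits a z).trans_lt
      (strictMonoOn_diskNorm (hAr a ha) (norm_nonneg _) hr.le hz)
  have hne : g.roots.toFinset.Nonempty := by
    rw [Multiset.toFinset_nonempty, ← Multiset.card_pos, hcard]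
    exact hf
  refine ⟨A, rad, ?_, ?_, fun a ha => (hrad a (hAr a ha)).1, ?_, ?_, ?_⟩
  · rw [Nat.one_le_iff_ne_zero, Finset.card_ne_zero, ← Finset.image_nonempty (f := fun a => ball a (rad a)),
      himage]
    exact hne.image _
  · rw [← hcard]
    exact (Finset.card_le_card hA).trans (Multiset.toFinset_card_le _)
  · intro a ha a' ha' haa'
    obtain ⟨hr, hrs⟩ := hrad a (hAr a ha)
    obtain ⟨hr', hrs'⟩ := hrad a' (hAr a' ha')
    by_contra h
    exact haa' (hinj ha ha' (ball_eq_ball_of_diskNorm_eq (hAr a ha) (hAr a' ha') hr.le hr'.le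
      (hrs.trans hrs'.symm) h))
  · ext z
    simp only [Set.mem_iUnion, Set.mem_preimage, exists_prop]
    refine ⟨fun ⟨a, ha, hz⟩ => hmaps a ha z hz, fun hz => ?_⟩
    obtain ⟨a, ha, hmin⟩ := Finset.exists_min_image _ (fun x => ‖z - x‖) hne
    rw [Multiset.mem_toFinset] at ha
    obtain ⟨hr, hrs⟩ := hrad a ha
    rw [hmem, norm_eval_eq_diskNorm_of_nearest hsplits (a := a)
      fun x hx => hmin x (Multiset.mem_toFinset.2 hx), ← hrs,
      (strictMonoOn_diskNorm ha).lt_iff_lt (norm_nonneg _) hr.le, ← dist_eq_norm,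
      ← mem_ball] at hz
    obtain ⟨a', ha', hball⟩ := Finset.mem_image.1
      (himage ▸ Finset.mem_image_of_mem _ (Multiset.mem_toFinset.2 ha))
    exact ⟨a', ha', by rwa [hball]⟩
  · intro a ha
    obtain ⟨hr, hrs⟩ := hrad a (hAr a ha)
    refine Set.Subset.antisymm (Set.image_subset_iff.2 (hmaps a ha)) fun w hw => ?_
    obtain ⟨z, hz, hzw⟩ := exists_mem_ball_eval_eq (hAr a ha) hr (w := w - b)
      (by rwa [hrs, ← dist_eq_norm])
    exact ⟨z, hz, sub_left_injective ((heval z).symm.trans hzw)⟩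
end

section
/- Let f ∈ K[z] be a nonconstant polynomial, a ∈ K, r > 0, and suppose f is injective on the closed disk D̄(a,r). Then for every x ∈ D̄(a,r) one has f(D̄(a,r)) = D̄(f(x), ‖f'(x)‖ · r); in particular, the image is a closed disk whose diameter equals ‖f'(x)‖ times the diameter of D̄(a,r), for any choice of x in the disk. -/
open Polynomial Metric

/-- A nonzero polynomial over an algebraically closed field is a constant times the product of
`X - C σ` over its roots `σ`. -/
lemma eq_C_mul_prod_roots {K : Type*} [Field K] [IsAlgClosed K] (q : K[X]) :
    q = C q.leadingCoeff * (q.roots.map fun σ => X - C σ).prod :=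
  (IsAlgClosed.splits q).eq_prod_roots

/-- Over an ultrametric field, a polynomial without roots in `closedBall x r` satisfies
`‖q'(x)‖ * r < ‖q(x)‖`. -/
lemma norm_eval_derivative_mul_lt {K : Type*} [NormedField K] [IsUltrametricDist K]
    [IsAlgClosed K] {q : K[X]} (hq : q ≠ 0) {x : K} {r : ℝ} (hr : 0 < r)
    (h : ∀ σ, q.IsRoot σ → r < ‖x - σ‖) :
    ‖q.derivative.eval x‖ * r < ‖q.eval x‖ := by
  have key : ∀ s : Multiset K, (∀ σ ∈ s, r < ‖x - σ‖) →
      ‖(C q.leadingCoeff * (s.map fun σ => X - C σ).prod).derivative.eval x‖ * r <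
        ‖(C q.leadingCoeff * (s.map fun σ => X - C σ).prod).eval x‖ := by
    intro s
    induction s using Multiset.induction_on with
    | empty => simpa using hq
    | cons σ s ih =>
      intro hs
      have hσ := hs σ (Multiset.mem_cons_self σ s)
      have ih := ih fun τ hτ => hs τ (Multiset.mem_cons_of_mem hτ)
      rw [Multiset.map_cons, Multiset.prod_cons, mul_left_comm]
      generalize C q.leadingCoeff * (s.map fun σ => X - C σ).prod = g at ih
      have hg : 0 < ‖g.eval x‖ := lt_of_le_of_lt (by positivity) ih
      simp only [derivative_mul, derivative_sub, derivative_X, derivative_C, sub_zero, one_mul,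
        eval_add, eval_mul, eval_sub, eval_X, eval_C, norm_mul]
      calc _ ≤ max ‖g.eval x‖ ‖(x - σ) * g.derivative.eval x‖ * r := by
            gcongr
            exact IsUltrametricDist.norm_add_le_max _ _
        _ < _ := by
            rw [max_mul_of_nonneg _ _ hr.le, norm_mul]
            refine max_lt ?_ ?_
            · rw [mul_comm]
              gcongr
            · rw [mul_assoc]
              have : 0 < ‖x - σ‖ := hr.trans hσ
              gcongr
  rw [eq_C_mul_prod_roots q]
  exact key _ fun σ hσ => h σ (isRoot_of_mem_roots hσ)

/-- Over an ultrametric field, a polynomial without roots in `closedBall x r` has constant norm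
there. -/
lemma norm_eval_eq_of_no_roots {K : Type*} [NormedField K] [IsUltrametricDist K]
    [IsAlgClosed K] {q : K[X]} {x z : K} {r : ℝ} (hz : ‖z - x‖ ≤ r)
    (h : ∀ σ, q.IsRoot σ → r < ‖x - σ‖) :
    ‖q.eval z‖ = ‖q.eval x‖ := by
  have key : ∀ s : Multiset K, (∀ σ ∈ s, r < ‖x - σ‖) →
      ‖(C q.leadingCoeff * (s.map fun σ => X - C σ).prod).eval z‖ =
        ‖(C q.leadingCoeff * (s.map fun σ => X - C σ).prod).eval x‖ := by
    intro s
    induction s using Multiset.induction_on with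
    | empty => simp
    | cons σ s ih =>
      intro hs
      have hσ := hs σ (Multiset.mem_cons_self σ s)
      have ih := ih fun τ hτ => hs τ (Multiset.mem_cons_of_mem hτ)
      rw [Multiset.map_cons, Multiset.prod_cons, mul_left_comm]
      generalize C q.leadingCoeff * (s.map fun σ => X - C σ).prod = g at ih
      simp only [eval_mul, eval_sub, eval_X, eval_C, norm_mul, ih]
      congr 1
      have hlt : ‖z - x‖ < ‖x - σ‖ := hz.trans_lt hσ
      have := IsUltrametricDist.norm_add_eq_max_of_norm_ne_norm hlt.ne
      rw [sub_add_sub_cancel, max_eq_right hlt.le] at this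
      exact this
  rw [eq_C_mul_prod_roots q]
  exact key _ fun σ hσ => h σ (isRoot_of_mem_roots hσ)

/-- A polynomial of positive degree over an algebraically closed ultrametric field of
characteristic zero has no critical point in a closed disk on which it is injective. -/
lemma eval_derivative_ne_zero_of_injOn
    {K : Type*} [NontriviallyNormedField K] [IsUltrametricDist K] [IsAlgClosed K] [CharZero K]
    {f : K[X]} (hf : 0 < f.natDegree) {x : K} {r : ℝ} (hr : 0 < r)
    (hinj : Set.InjOn (fun z => f.eval z) (closedBall x r)) :
    f.derivative.eval x ≠ 0 := by
  classical
  intro hx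
  have hf' : f.derivative ≠ 0 := fun h => hf.ne' (derivative_eq_zero.mp h)
  obtain ⟨w, hw, hwx⟩ := (infinite_of_mem_nhds x (closedBall_mem_nhds x hr)).exists_notMem_finset
    f.derivative.roots.toFinset
  have hw' : f.derivative.eval w ≠ 0 := by simpa [hf'] using hwx
  have hfw : f - C (f.eval w) ≠ 0 := fun h => by
    rw [sub_eq_zero.mp h] at hf
    simp at hf
  obtain ⟨q, hq⟩ := X_sub_C_dvd_sub_C_eval (a := w) (p := f)
  have hq0 : q ≠ 0 := by
    rintro rfl
    exact hfw (by simpa using hq)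
  have hder : ∀ y, f.derivative.eval y = q.eval y + (y - w) * q.derivative.eval y := fun y => by
    simpa using congrArg (fun p => p.derivative.eval y) hq
  have hroot : ∀ σ, q.IsRoot σ → r < ‖x - σ‖ := by
    intro σ hσ
    by_contra! hle
    have h1 : f.eval σ = f.eval w := by
      have := congrArg (eval σ) hq
      rw [eval_mul, hσ.eq_zero, mul_zero] at this
      simpa [sub_eq_zero] using this
    have h2 : σ = w := hinj (by rwa [mem_closedBall, dist_comm, dist_eq_norm]) hw h1
    subst h2
    exact hw' (by simp [hder, hσ.eq_zero])
  have hlt := norm_eval_derivative_mul_lt hq0 hr hroot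
  have heq : ‖q.eval x‖ = ‖x - w‖ * ‖q.derivative.eval x‖ := by
    rw [← norm_mul, ← norm_neg]
    congr 1
    linear_combination hder x - hx
  rw [mem_closedBall, dist_comm, dist_eq_norm] at hw
  nlinarith [norm_nonneg (q.derivative.eval x)]

/-- On a closed disk on which it is injective, a polynomial scales all distances from the center
by the norm of its derivative there. -/
lemma norm_eval_sub_eval_of_injOn
    {K : Type*} [NontriviallyNormedField K] [IsUltrametricDist K] [IsAlgClosed K] [CharZero K]
    {f : K[X]} (hf : 0 < f.natDegree) {x z : K} {r : ℝ} (hr : 0 < r)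
    (hinj : Set.InjOn (fun z => f.eval z) (closedBall x r)) (hz : z ∈ closedBall x r) :
    ‖f.eval z - f.eval x‖ = ‖f.derivative.eval x‖ * ‖z - x‖ := by
  obtain ⟨q, hq⟩ := X_sub_C_dvd_sub_C_eval (a := x) (p := f)
  have hder : f.derivative.eval x = q.eval x := by
    simpa using congrArg (fun p => p.derivative.eval x) hq
  have hev : ∀ y, f.eval y - f.eval x = (y - x) * q.eval y := fun y => by
    simpa using congrArg (eval y) hq
  have hroot : ∀ σ, q.IsRoot σ → r < ‖x - σ‖ := by
    intro σ hσ
    by_contra! hle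
    have h1 : f.eval σ = f.eval x := by
      rw [← sub_eq_zero, hev, hσ.eq_zero, mul_zero]
    have h2 : σ = x := hinj (by rwa [mem_closedBall, dist_comm, dist_eq_norm])
      (mem_closedBall_self hr.le) h1
    subst h2
    exact eval_derivative_ne_zero_of_injOn hf hr hinj (hder.trans hσ)
  rw [hev, norm_mul, norm_eval_eq_of_no_roots (by rwa [← dist_eq_norm]) hroot, hder, mul_comm]

/-- If a nonconstant polynomial `f` over an algebraically closed, complete nonarchimedean
field is injective on a closed disk `D̄(a,r)`, then for every `x` in the disk the image is the
closed disk centered at `f(x)` of radius `‖f'(x)‖ · r`. -/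
theorem image_closedBall_of_injOn
    {K : Type*} [NontriviallyNormedField K] [IsUltrametricDist K]
    [IsAlgClosed K] [CharZero K] [CompleteSpace K]
    (f : Polynomial K) (hf : 0 < f.natDegree) (a : K) (r : ℝ) (hr : 0 < r)
    (hinj : Set.InjOn (fun z => f.eval z) (closedBall a r)) :
    ∀ x ∈ closedBall a r,
      (fun z => f.eval z) '' closedBall a r =
        closedBall (f.eval x) (‖(Polynomial.derivative f).eval x‖ * r) := by
  intro x hx
  rw [IsUltrametricDist.closedBall_eq_of_mem hx] at hinj ⊢
  refine Set.Subset.antisymm ?_ fun b hb => ?_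
  · rintro _ ⟨z, hz, rfl⟩
    rw [mem_closedBall, dist_eq_norm, norm_eval_sub_eval_of_injOn hf hr hinj hz]
    rw [mem_closedBall, dist_eq_norm] at hz
    gcongr
  · by_contra hne
    have hfb : f - C b ≠ 0 := fun h => by
      rw [sub_eq_zero.mp h] at hf
      simp at hf
    have hlt := norm_eval_derivative_mul_lt hfb hr (x := x) fun σ hσ => by
      by_contra! hle
      refine hne ⟨σ, by rwa [mem_closedBall, dist_comm, dist_eq_norm], ?_⟩
      simpa [sub_eq_zero] using hσ
    rw [mem_closedBall, dist_comm, dist_eq_norm] at hb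
    simp only [derivative_sub, derivative_C, sub_zero, eval_sub, eval_C] at hlt
    exact hlt.not_ge hb
end

section
/- Let f ∈ K[z] be a nonconstant polynomial, x₀ ∈ K, r > 0, and set s := sup_{z ∈ D̄(x₀,r)} ‖f(z) − f(x₀)‖. Let m be the number of solutions of f(z) = f(x₀) in D̄(x₀,r), counted with multiplicity. Then r · sup_{z ∈ D̄(x₀,r)} ‖f'(z)‖ ≥ ‖(m : K)‖ · s, where (m : K) is the image of the natural number m in K. -/
open Polynomial Metric
open scoped Classical

section RootsOfUnity

variable {K : Type*} [Field K]

/-- Coefficient extraction by averaging over the `N`-th roots of unity. -/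
lemma IsPrimitiveRoot.sum_pow_mul_eval {N : ℕ} {ω : K} (hω : IsPrimitiveRoot ω N)
    (p : K[X]) (hp : p.natDegree < N) (z : K) {k : ℕ} (hk : k < N) :
    ∑ i ∈ Finset.range N, (ω ^ i) ^ (N - k) * p.eval (ω ^ i * z) = N * (p.coeff k * z ^ k) := by
  have key (j : ℕ) (hj : j < N) :
      ∑ i ∈ Finset.range N, (ω ^ (N - k + j)) ^ i = if j = k then (N : K) else 0 := by
    split_ifs with h
    · subst h
      simp [Nat.sub_add_cancel hk.le, hω.pow_eq_one]
    · have hne : ω ^ (N - k + j) ≠ 1 := by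
        intro h1
        obtain ⟨c, hc⟩ := (hω.pow_eq_one_iff_dvd _).1 h1
        have h2 : c < 2 := by
          by_contra! h2
          have := Nat.mul_le_mul_left N h2
          omega
        interval_cases c <;> omega
      rw [geom_sum_eq hne, ← pow_mul, mul_comm, pow_mul, hω.pow_eq_one]
      simp
  calc _ = ∑ i ∈ Finset.range N, ∑ j ∈ Finset.range N,
        (ω ^ (N - k + j)) ^ i * (p.coeff j * z ^ j) := by
        refine Finset.sum_congr rfl fun i _ => ?_
        rw [eval_eq_sum_range' hp, Finset.mul_sum]
        refine Finset.sum_congr rfl fun j _ => ?_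
        rw [mul_pow, ← pow_mul ω (N - k + j), add_mul, pow_add, ← pow_mul, ← pow_mul,
          mul_comm i, mul_comm i]
        ring
    _ = _ := by
        rw [Finset.sum_comm, Finset.sum_eq_single k]
        · rw [← Finset.sum_mul, key k hk, if_pos rfl]
        · intro j hj hjk
          rw [← Finset.sum_mul, key j (Finset.mem_range.1 hj), if_neg hjk, zero_mul]
        · intro h
          exact absurd (Finset.mem_range.2 hk) h

end RootsOfUnity

section NormedField

variable {K : Type*} [NontriviallyNormedField K]

lemma exists_coeff_mul_pow_le (p : K[X]) (r : ℝ) : ∃ B, ∀ k, ‖p.coeff k‖ * r ^ k ≤ B := by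
  obtain ⟨B, hB⟩ :=
    ((Finset.range (p.natDegree + 1)).image fun k => ‖p.coeff k‖ * r ^ k).bddAbove
  refine ⟨max B 0, fun k => ?_⟩
  by_cases hk : k ≤ p.natDegree
  · exact le_max_of_le_left
      (hB (Finset.mem_coe.2 (Finset.mem_image_of_mem _ (Finset.mem_range.2 (by omega)))))
  · simp [coeff_eq_zero_of_natDegree_lt (not_le.1 hk)]

/-- The norms of an algebraically closed valued field are dense in the positive reals. -/
lemma IsAlgClosed.exists_lt_norm_le [IsAlgClosed K] {ρ r : ℝ} (hρ : 0 < ρ) (h : ρ < r) :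
    ∃ z : K, ρ < ‖z‖ ∧ ‖z‖ ≤ r := by
  obtain ⟨y, hy⟩ := NormedField.exists_one_lt_norm K
  have hq : 1 < r / ρ := (one_lt_div hρ).2 h
  obtain ⟨n, hn⟩ := pow_unbounded_of_one_lt ‖y‖ hq
  have hn0 : n ≠ 0 := by
    rintro rfl
    rw [pow_zero] at hn
    exact absurd hy hn.le.not_gt
  obtain ⟨w, hw⟩ := IsAlgClosed.exists_pow_nat_eq y (Nat.pos_of_ne_zero hn0)
  have hw' : ‖w‖ ^ n = ‖y‖ := by rw [← norm_pow, hw]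
  have hw1 : 1 < ‖w‖ := by
    rw [← hw'] at hy
    exact (one_lt_pow_iff_of_nonneg (norm_nonneg _) hn0).1 hy
  have hw2 : ‖w‖ < r / ρ := by
    rw [← hw'] at hn
    exact lt_of_pow_lt_pow_left₀ n (by positivity) hn
  obtain ⟨j, hj1, hj2⟩ := exists_mem_Ico_zpow (hρ.trans h) hw1
  refine ⟨w ^ j, ?_, by rwa [norm_zpow]⟩
  have hw0 : 0 < ‖w‖ := zero_lt_one.trans hw1
  rw [norm_zpow]
  rw [zpow_add_one₀ hw0.ne'] at hj2
  have h3 : ‖w‖ ^ j * ‖w‖ < ‖w‖ ^ j * (r / ρ) := mul_lt_mul_of_pos_left hw2 (by positivity)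
  have h4 := hj2.trans h3
  rw [← mul_div_assoc, lt_div_iff₀ hρ, mul_comm] at h4
  exact lt_of_mul_lt_mul_right h4 (hρ.trans h).le

end NormedField

section Ultrametric

variable {K : Type*} [NontriviallyNormedField K] [IsUltrametricDist K]

lemma IsUltrametricDist.norm_sub_le_max_norm (x y : K) : ‖x - y‖ ≤ max ‖x‖ ‖y‖ := by
  simpa [sub_eq_add_neg] using norm_add_le_max x (-y)

lemma IsUltrametricDist.norm_sub_eq_max_of_norm_ne_norm {x y : K} (h : ‖x‖ ≠ ‖y‖) :
    ‖x - y‖ = max ‖x‖ ‖y‖ := by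
  simpa [sub_eq_add_neg] using norm_add_eq_max_of_norm_ne_norm (x := x) (y := -y) (by simpa)

/-- There are arbitrarily large natural numbers of norm one. -/
lemma exists_natCast_norm_eq_one (n : ℕ) : ∃ N, n < N ∧ ‖(N : K)‖ = 1 := by
  by_contra! h
  have h1 := (IsUltrametricDist.norm_natCast_le_one K (n + 1)).lt_of_ne (h (n + 1) (by omega))
  have h2 := (IsUltrametricDist.norm_natCast_le_one K (n + 2)).lt_of_ne (h (n + 2) (by omega))
  have h3 : ((n + 2 : ℕ) : K) - ((n + 1 : ℕ) : K) = 1 := by push_cast; ring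
  have h4 := IsUltrametricDist.norm_sub_le_max_norm ((n + 2 : ℕ) : K) ((n + 1 : ℕ) : K)
  rw [h3, norm_one] at h4
  exact absurd h4 (not_le.2 (max_lt h2 h1))

/-- A polynomial is bounded on a closed disk about zero by the maximum of `‖aₖ‖ rᵏ`. -/
lemma norm_eval_le_of_coeff_le {p : K[X]} {r B : ℝ} (hB : ∀ k, ‖p.coeff k‖ * r ^ k ≤ B)
    {z : K} (hz : ‖z‖ ≤ r) : ‖p.eval z‖ ≤ B := by
  rw [eval_eq_sum_range]
  refine IsUltrametricDist.norm_sum_le_of_forall_le_of_nonempty (by simp) fun k _ => ?_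
  rw [norm_mul, norm_pow]
  exact (by gcongr : ‖p.coeff k‖ * ‖z‖ ^ k ≤ ‖p.coeff k‖ * r ^ k).trans (hB k)

lemma bddAbove_norm_eval_closedBall (p : K[X]) (a : K) (r : ℝ) :
    BddAbove ((fun z => ‖p.eval z‖) '' closedBall a r) := by
  obtain ⟨B, hB⟩ := exists_coeff_mul_pow_le (taylor a p) r
  refine ⟨B, ?_⟩
  rintro _ ⟨z, hz, rfl⟩
  have := norm_eval_le_of_coeff_le hB (mem_closedBall_iff_norm.1 hz)
  rwa [taylor_eval, sub_add_cancel] at this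

/-- For a product of linear factors, the last dominant term of the expansion at `a` on the
closed disk of radius `r` has index the number of roots in that disk. -/
lemma norm_coeff_taylor_prod_le (a : K) {r : ℝ} (hr : 0 < r) (t : Multiset K) :
    let q := taylor a (t.map fun x => X - C x).prod
    let m := (t.filter (· ∈ closedBall a r)).card
    (∀ k, ‖q.coeff k‖ * r ^ k ≤ ‖q.coeff m‖ * r ^ m) ∧
      ∀ k, m < k → ‖q.coeff k‖ * r ^ k < ‖q.coeff m‖ * r ^ m := by
  induction t using Multiset.induction_on with
  | empty =>
    have h (k : ℕ) (hk : k ≠ 0) : ‖(1 : K[X]).coeff k‖ * r ^ k < 1 := by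
      simp [coeff_one, hk]
    simp only [Multiset.map_zero, Multiset.prod_zero, taylor_one, C_1, Multiset.filter_zero,
      Multiset.card_zero, coeff_one_zero, norm_one, pow_zero, mul_one]
    refine ⟨fun k => ?_, fun k hk => h k hk.ne'⟩
    rcases eq_or_ne k 0 with rfl | hk
    · simp
    · exact (h k hk).le
  | cons x t ih =>
    simp only [Multiset.map_cons, Multiset.prod_cons, taylor_mul, map_sub, taylor_X, taylor_C]
    simp only at ih
    set q := taylor a (t.map fun x => X - C x).prod
    set m := (t.filter (· ∈ closedBall a r)).card
    obtain ⟨hle, hlt⟩ := ih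
    set M := ‖q.coeff m‖ * r ^ m
    have hM : 0 < M := lt_of_le_of_lt (by positivity) (hlt (m + 1) (by omega))
    have hfac : X + C a - C x = X - C (x - a) := by rw [C_sub]; ring
    rw [hfac]
    set ξ := x - a
    have hc0 : ((X - C ξ) * q).coeff 0 = -(ξ * q.coeff 0) := by simp [sub_mul]
    have hc (k : ℕ) : ((X - C ξ) * q).coeff (k + 1) = q.coeff k - ξ * q.coeff (k + 1) := by
      simp [sub_mul]
    have e1 (k : ℕ) : ‖q.coeff k‖ * r ^ (k + 1) = r * (‖q.coeff k‖ * r ^ k) := by ring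
    have e2 (k : ℕ) : ‖ξ * q.coeff k‖ * r ^ k = ‖ξ‖ * (‖q.coeff k‖ * r ^ k) := by
      rw [norm_mul]; ring
    have hmax (k : ℕ) : ‖((X - C ξ) * q).coeff (k + 1)‖ * r ^ (k + 1) ≤
        max (r * (‖q.coeff k‖ * r ^ k)) (‖ξ‖ * (‖q.coeff (k + 1)‖ * r ^ (k + 1))) := by
      rw [hc, ← e1, ← e2, ← max_mul_of_nonneg _ _ (by positivity)]
      exact mul_le_mul_of_nonneg_right (IsUltrametricDist.norm_sub_le_max_norm _ _) (by positivity)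
    have hzero : ‖((X - C ξ) * q).coeff 0‖ * r ^ 0 ≤ ‖ξ‖ * M := by
      rw [hc0, norm_neg, e2]
      exact mul_le_mul_of_nonneg_left (hle 0) (norm_nonneg _)
    by_cases hx : x ∈ closedBall a r
    · have hcard : ((x ::ₘ t).filter (· ∈ closedBall a r)).card = m + 1 := by
        rw [Multiset.filter_cons_of_pos (p := (· ∈ closedBall a r)) t hx, Multiset.card_cons]
      rw [hcard]
      have hξ : ‖ξ‖ ≤ r := mem_closedBall_iff_norm.1 hx
      have hsmall (k : ℕ) (hk : m < k) : ‖ξ‖ * (‖q.coeff k‖ * r ^ k) < r * M :=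
        (mul_le_mul_of_nonneg_right hξ (by positivity)).trans_lt
          (mul_lt_mul_of_pos_left (hlt k hk) hr)
      have htop : ‖((X - C ξ) * q).coeff (m + 1)‖ * r ^ (m + 1) = r * M := by
        have h : ‖ξ * q.coeff (m + 1)‖ < ‖q.coeff m‖ := by
          have := hsmall (m + 1) (by omega)
          rw [← e2, ← e1] at this
          exact lt_of_mul_lt_mul_right this (by positivity)
        rw [hc, IsUltrametricDist.norm_sub_eq_max_of_norm_ne_norm h.ne', max_eq_left h.le, e1]
      rw [htop]
      refine ⟨fun k => ?_, fun k hk => ?_⟩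
      · cases k with
        | zero => exact hzero.trans (mul_le_mul_of_nonneg_right hξ hM.le)
        | succ k => exact (hmax k).trans (max_le (mul_le_mul_of_nonneg_left (hle k) hr.le)
            (mul_le_mul hξ (hle _) (by positivity) hr.le))
      · cases k with
        | zero => omega
        | succ k => exact (hmax k).trans_lt (max_lt
            (mul_lt_mul_of_pos_left (hlt k (by omega)) hr) (hsmall _ (by omega)))
    · have hcard : ((x ::ₘ t).filter (· ∈ closedBall a r)).card = m := by
        rw [Multiset.filter_cons_of_neg (p := (· ∈ closedBall a r)) t hx]
      rw [hcard]
      have hξ : r < ‖ξ‖ := not_le.1 fun h => hx (mem_closedBall_iff_norm.2 h)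
      have hξ0 : 0 < ‖ξ‖ := hr.trans hξ
      have hsmall (k : ℕ) : r * (‖q.coeff k‖ * r ^ k) < ‖ξ‖ * M :=
        (mul_le_mul_of_nonneg_left (hle k) hr.le).trans_lt (mul_lt_mul_of_pos_right hξ hM)
      have htop : ‖((X - C ξ) * q).coeff m‖ * r ^ m = ‖ξ‖ * M := by
        rcases hm : m with _ | n
        · rw [hc0, norm_neg, e2, ← hm]
        · have h : ‖q.coeff n‖ < ‖ξ * q.coeff (n + 1)‖ := by
            have := hsmall n
            rw [← e1] at this
            simp only [M, hm] at this
            rw [← e2] at this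
            exact lt_of_mul_lt_mul_right this (by positivity)
          rw [hc, IsUltrametricDist.norm_sub_eq_max_of_norm_ne_norm h.ne, max_eq_right h.le,
            e2, ← hm]
      rw [htop]
      refine ⟨fun k => ?_, fun k hk => ?_⟩
      · cases k with
        | zero => exact hzero
        | succ k => exact (hmax k).trans (max_le (hsmall k).le
            (mul_le_mul_of_nonneg_left (hle _) hξ0.le))
      · cases k with
        | zero => omega
        | succ k => exact (hmax k).trans_lt (max_lt (hsmall k)
            (mul_lt_mul_of_pos_left (hlt _ hk) hξ0))

variable [IsAlgClosed K] [CharZero K]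

/-- Cauchy's estimate on a circle for polynomials over a nonarchimedean field. -/
lemma norm_coeff_mul_pow_le_of_norm_eval_le {p : K[X]} {ρ S : ℝ}
    (hS : ∀ z : K, ‖z‖ = ρ → ‖p.eval z‖ ≤ S) {z : K} (hz : ‖z‖ = ρ) (k : ℕ) :
    ‖p.coeff k‖ * ρ ^ k ≤ S := by
  have hS0 : 0 ≤ S := (norm_nonneg _).trans (hS z hz)
  obtain ⟨N, hN, hN1⟩ := exists_natCast_norm_eq_one (K := K) (max p.natDegree k)
  have : NeZero N := ⟨by omega⟩
  obtain ⟨ω, hω⟩ := HasEnoughRootsOfUnity.exists_primitiveRoot K N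
  have hω1 : ‖ω‖ = 1 := by
    refine (pow_eq_one_iff_of_nonneg (norm_nonneg ω) (NeZero.ne N)).1 ?_
    rw [← norm_pow, hω.pow_eq_one, norm_one]
  have h := congrArg norm (hω.sum_pow_mul_eval p (by omega) z (k := k) (by omega))
  rw [norm_mul, hN1, one_mul, norm_mul, norm_pow, hz] at h
  rw [← h]
  refine IsUltrametricDist.norm_sum_le_of_forall_le_of_nonneg hS0 fun i _ => ?_
  rw [norm_mul, norm_pow, norm_pow, hω1, one_pow, one_pow, one_mul]
  exact hS _ (by rw [norm_mul, norm_pow, hω1, one_pow, one_mul, hz])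

/-- Cauchy's estimate on a closed disk for polynomials over a nonarchimedean field. -/
lemma norm_coeff_taylor_mul_pow_le_sSup (p : K[X]) (a : K) {r : ℝ} (hr : 0 < r) (k : ℕ) :
    ‖(taylor a p).coeff k‖ * r ^ k ≤ sSup ((fun z => ‖p.eval z‖) '' closedBall a r) := by
  set S := sSup ((fun z => ‖p.eval z‖) '' closedBall a r)
  have hS (z : K) (hz : ‖z‖ ≤ r) : ‖(taylor a p).eval z‖ ≤ S := by
    rw [taylor_eval]
    exact le_csSup (bddAbove_norm_eval_closedBall p a r)
      ⟨z + a, by simpa [mem_closedBall_iff_norm] using hz, rfl⟩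
  have hlim : Filter.Tendsto (fun ρ : ℝ => ‖(taylor a p).coeff k‖ * ρ ^ k)
      (nhdsWithin r (Set.Iio r))
      (nhds (‖(taylor a p).coeff k‖ * r ^ k)) :=
    ((by fun_prop : Continuous fun ρ : ℝ => ‖(taylor a p).coeff k‖ * ρ ^ k).tendsto r).mono_left
      nhdsWithin_le_nhds
  refine le_of_tendsto hlim ?_
  filter_upwards [Ioo_mem_nhdsLT hr] with ρ hρ
  obtain ⟨z, hz1, hz2⟩ := IsAlgClosed.exists_lt_norm_le (K := K) hρ.1 hρ.2
  have hρ0 := hρ.1.le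
  calc ‖(taylor a p).coeff k‖ * ρ ^ k ≤ ‖(taylor a p).coeff k‖ * ‖z‖ ^ k := by gcongr
    _ ≤ S := norm_coeff_mul_pow_le_of_norm_eval_le (fun w hw => hS w (hw.trans_le hz2)) rfl k

end Ultrametric

/-- Distortion lower bound: for a nonconstant polynomial `f` over an algebraically closed,
complete nonarchimedean field, with `s` the radius of the image of the closed disk `D̄(x₀,r)`
and `m` the number of solutions of `f(z) = f(x₀)` in `D̄(x₀,r)` counted with multiplicity,
one has `r · sup_{D̄(x₀,r)} ‖f'‖ ≥ ‖(m : K)‖ · s`. -/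
theorem mul_sSup_norm_deriv_ge
    {K : Type*} [NontriviallyNormedField K] [IsUltrametricDist K]
    [IsAlgClosed K] [CharZero K] [CompleteSpace K]
    (f : Polynomial K) (hf : 0 < f.natDegree) (x₀ : K) (r : ℝ) (hr : 0 < r)
    (s : ℝ) (hs : s = sSup ((fun z => ‖f.eval z - f.eval x₀‖) '' closedBall x₀ r))
    (m : ℕ)
    (hm : m = Multiset.card
      (((f - Polynomial.C (f.eval x₀)).roots).filter (· ∈ closedBall x₀ r))) :
    r * sSup ((fun z => ‖(Polynomial.derivative f).eval z‖) '' closedBall x₀ r) ≥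
      ‖(m : K)‖ * s := by
  rcases m with _ | n
  · have h0 : 0 ≤ sSup ((fun z => ‖(derivative f).eval z‖) '' closedBall x₀ r) :=
      Real.sSup_nonneg (by rintro _ ⟨z, -, rfl⟩; exact norm_nonneg _)
    simpa using mul_nonneg hr.le h0
  set g := f - C (f.eval x₀) with hg
  have hderiv : derivative f = derivative g := by simp [hg]
  have hcoeff : (taylor x₀ (derivative f)).coeff n = (taylor x₀ g).coeff (n + 1) * (n + 1) := by
    have h : taylor x₀ (derivative g) = derivative (taylor x₀ g) := by
      simp [taylor_apply, derivative_comp]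
    rw [hderiv, h, coeff_derivative]
  have hbound (k : ℕ) : ‖(taylor x₀ g).coeff k‖ * r ^ k ≤
      ‖(taylor x₀ g).coeff (n + 1)‖ * r ^ (n + 1) := by
    have h := (norm_coeff_taylor_prod_le x₀ hr g.roots).1 k
    rw [← hm] at h
    have hsplit : taylor x₀ g =
        C g.leadingCoeff * taylor x₀ (g.roots.map fun x => X - C x).prod := by
      conv_lhs => rw [(IsAlgClosed.splits g).eq_prod_roots, taylor_mul, taylor_C]
    rw [hsplit, coeff_C_mul, coeff_C_mul, norm_mul, norm_mul, mul_assoc, mul_assoc]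
    exact mul_le_mul_of_nonneg_left h (norm_nonneg _)
  have hs_le : s ≤ ‖(taylor x₀ g).coeff (n + 1)‖ * r ^ (n + 1) := by
    rw [hs]
    refine csSup_le ((nonempty_closedBall.2 hr.le).image _) ?_
    rintro _ ⟨z, hz, rfl⟩
    have h := norm_eval_le_of_coeff_le hbound (mem_closedBall_iff_norm.1 hz)
    rw [taylor_eval, sub_add_cancel] at h
    simpa [hg] using h
  calc ‖((n + 1 : ℕ) : K)‖ * s
      ≤ ‖((n + 1 : ℕ) : K)‖ * (‖(taylor x₀ g).coeff (n + 1)‖ * r ^ (n + 1)) :=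
        mul_le_mul_of_nonneg_left hs_le (norm_nonneg _)
    _ = r * (‖(taylor x₀ (derivative f)).coeff n‖ * r ^ n) := by
        rw [hcoeff, norm_mul]
        push_cast
        ring
    _ ≤ r * sSup ((fun z => ‖(derivative f).eval z‖) '' closedBall x₀ r) :=
        mul_le_mul_of_nonneg_left (norm_coeff_taylor_mul_pow_le_sSup _ _ hr n) hr.le
end

section
/- Let f ∈ K[z] be a nonconstant polynomial of degree d, x₀ ∈ K, r > 0, and set s := sup_{z ∈ D̄(x₀,r)} ‖f(z) − f(x₀)‖. Then r · sup_{z ∈ D̄(x₀,r)} ‖f'(z)‖ ≥ (min_{1 ≤ ℓ ≤ d} ‖(ℓ : K)‖) · s, where (ℓ : K) is the image of the natural number ℓ in K. (The constant min_{1 ≤ ℓ ≤ d} ‖(ℓ : K)‖ is p^{κ_d} in the paper's notation.) -/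
open Polynomial Metric

section UltrametricPolynomial

variable {K : Type*}

theorem exists_lt_norm_le_of_isAlgClosed [NontriviallyNormedField K] [IsAlgClosed K]
    {t r : ℝ} (ht : 0 < t) (htr : t < r) : ∃ c : K, t < ‖c‖ ∧ ‖c‖ ≤ r := by
  have hr : 0 < r := ht.trans htr
  obtain ⟨a, ha⟩ := NormedField.exists_one_lt_norm K
  have ha0 : 0 < ‖a‖ := one_pos.trans ha
  obtain ⟨n, hn⟩ := pow_unbounded_of_one_lt ‖a‖ ((one_lt_div ht).mpr htr)
  have hn0 : n ≠ 0 := by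
    rintro rfl
    simp only [pow_zero] at hn
    exact absurd hn ha.not_gt
  obtain ⟨k, hk₁, hk₂⟩ := exists_mem_Ico_zpow (pow_pos hr n) ha
  obtain ⟨c, hc⟩ := IsAlgClosed.exists_pow_nat_eq (a ^ k) (Nat.pos_of_ne_zero hn0)
  have hcn : ‖c‖ ^ n = ‖a‖ ^ k := by rw [← norm_pow, hc, norm_zpow]
  refine ⟨c, ?_, ?_⟩
  · refine lt_of_pow_lt_pow_left₀ n (norm_nonneg c) ?_
    rw [div_pow, lt_div_iff₀ (pow_pos ht n)] at hn
    rw [zpow_add_one₀ ha0.ne'] at hk₂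
    rw [hcn]
    nlinarith
  · refine le_of_pow_le_pow_left₀ hn0 hr.le ?_
    rw [hcn]
    exact hk₁

theorem exists_gt_norm_natCast_eq_one [NormedField K] [IsUltrametricDist K] (d : ℕ) :
    ∃ n : ℕ, d < n ∧ ‖(n : K)‖ = 1 := by
  by_contra! h
  have h' : ∀ n : ℕ, d < n → ‖(n : K)‖ < 1 := fun n hn =>
    lt_of_le_of_ne (IsUltrametricDist.norm_natCast_le_one K n) (h n hn)
  have h₁ := h' (d + 1) (by omega)
  have h₂ := h' (d + 2) (by omega)
  have h₃ := IsUltrametricDist.norm_add_le_max ((d + 2 : ℕ) : K) (-((d + 1 : ℕ) : K))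
  rw [norm_neg,
    show ((d + 2 : ℕ) : K) + -((d + 1 : ℕ) : K) = 1 by push_cast; ring, norm_one] at h₃
  exact absurd h₃ (not_le.mpr (max_lt h₂ h₁))

/-- Discrete Fourier inversion for the coefficients of a polynomial. -/
theorem IsPrimitiveRoot.sum_eval_mul_pow [Field K] {n : ℕ} {ζ : K} (hζ : IsPrimitiveRoot ζ n)
    (g : K[X]) (hn : g.natDegree < n) (c : K) {i : ℕ} (hi : i < n) :
    ∑ j ∈ Finset.range n, g.eval (c * ζ ^ j) * (ζ ^ j) ^ (n - i) = n * (g.coeff i * c ^ i) := by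
  have key : ∀ l ∈ Finset.range n,
      ∑ j ∈ Finset.range n, g.coeff l * (c * ζ ^ j) ^ l * (ζ ^ j) ^ (n - i) =
        if l = i then n * (g.coeff i * c ^ i) else 0 := by
    intro l hl
    have hl : l < n := Finset.mem_range.mp hl
    have hterm : ∀ j, g.coeff l * (c * ζ ^ j) ^ l * (ζ ^ j) ^ (n - i) =
        g.coeff l * c ^ l * (ζ ^ (l + (n - i))) ^ j := by
      intro j
      rw [pow_right_comm ζ (l + (n - i)) j, pow_add, mul_pow]
      ring
    simp_rw [hterm, ← Finset.mul_sum]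
    split_ifs with h
    · subst h
      rw [Nat.add_sub_cancel' hl.le, hζ.pow_eq_one]
      simp [mul_comm]
    · have hne : ζ ^ (l + (n - i)) ≠ 1 := by
        intro h1
        obtain ⟨q, hq⟩ := (hζ.pow_eq_one_iff_dvd _).mp h1
        have hq0 : 0 < q := by
          rcases Nat.eq_zero_or_pos q with rfl | hq'
          · omega
          · exact hq'
        have hq2 : q < 2 := by
          by_contra! h2
          have := Nat.mul_le_mul_left n h2
          omega
        obtain rfl : q = 1 := by omega
        omega
      rw [geom_sum_eq hne, pow_right_comm, hζ.pow_eq_one]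
      simp
  simp_rw [eval_eq_sum_range' hn, Finset.sum_mul]
  rw [Finset.sum_comm, Finset.sum_congr rfl key, Finset.sum_ite_eq']
  simp [hi]

/-- Cauchy's estimate for polynomials over a nonarchimedean field. -/
theorem norm_coeff_mul_pow_le_of_forall_norm_eval_le [NontriviallyNormedField K]
    [IsUltrametricDist K] [IsAlgClosed K] [CharZero K] (g : K[X]) {r M : ℝ} (hr : 0 < r)
    (hM : ∀ z, ‖z‖ ≤ r → ‖g.eval z‖ ≤ M) (i : ℕ) : ‖g.coeff i‖ * r ^ i ≤ M := by
  have hM0 : 0 ≤ M := (norm_nonneg _).trans (hM 0 (by simpa using hr.le))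
  have hc : ∀ c : K, ‖c‖ ≤ r → ‖g.coeff i‖ * ‖c‖ ^ i ≤ M := by
    intro c hc
    obtain ⟨n, hn, hn1⟩ := exists_gt_norm_natCast_eq_one (K := K) (max g.natDegree i)
    have : NeZero (n : K) := ⟨norm_ne_zero_iff.mp (by rw [hn1]; exact one_ne_zero)⟩
    have : NeZero n := ⟨by omega⟩
    obtain ⟨ζ, hζ⟩ := HasEnoughRootsOfUnity.exists_primitiveRoot K n
    have hζ1 : ‖ζ‖ = 1 :=
      (pow_eq_one_iff_of_nonneg (norm_nonneg ζ) (NeZero.ne n)).mp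
        (by rw [← norm_pow, hζ.pow_eq_one, norm_one])
    have hsum := hζ.sum_eval_mul_pow g (by omega) c (i := i) (by omega)
    have hnorm : ‖g.coeff i‖ * ‖c‖ ^ i = ‖(n : K) * (g.coeff i * c ^ i)‖ := by
      rw [norm_mul, hn1, one_mul, norm_mul, norm_pow]
    rw [hnorm, ← hsum]
    refine IsUltrametricDist.norm_sum_le_of_forall_le_of_nonneg hM0 fun j _ => ?_
    rw [norm_mul, norm_pow, norm_pow, hζ1, one_pow, one_pow, mul_one]
    exact hM _ (by rwa [norm_mul, norm_pow, hζ1, one_pow, mul_one])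
  have hev : ∀ᶠ t in nhdsWithin r (Set.Iio r), ‖g.coeff i‖ * t ^ i ≤ M := by
    filter_upwards [Ioo_mem_nhdsLT hr] with t ht
    obtain ⟨c, htc, hcr⟩ := exists_lt_norm_le_of_isAlgClosed (K := K) ht.1 ht.2
    refine le_trans ?_ (hc c hcr)
    have := ht.1.le
    gcongr
  have hcont : Continuous fun t : ℝ => ‖g.coeff i‖ * t ^ i := by fun_prop
  exact le_of_tendsto (hcont.continuousAt.tendsto.mono_left nhdsWithin_le_nhds) hev

theorem bddAbove_norm_eval_image_closedBall [NormedField K] (g : K[X]) (x : K) (r : ℝ) :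
    BddAbove ((fun z => ‖g.eval z‖) '' closedBall x r) := by
  refine ⟨∑ i ∈ Finset.range (g.natDegree + 1), ‖g.coeff i‖ * (‖x‖ + r) ^ i, ?_⟩
  rintro _ ⟨z, hz, rfl⟩
  have hz' : ‖z‖ ≤ ‖x‖ + r := norm_le_of_mem_closedBall hz
  dsimp only
  rw [eval_eq_sum_range]
  refine (norm_sum_le _ _).trans (Finset.sum_le_sum fun i _ => ?_)
  rw [norm_mul, norm_pow]
  gcongr

end UltrametricPolynomial

/-- Distortion lower bound with the uniform constant `p^{κ_d} = min_{1 ≤ ℓ ≤ d} ‖(ℓ : K)‖`: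
for a nonconstant polynomial `f` of degree `d` over an algebraically closed, complete
nonarchimedean field, with `s` the radius of the image of the closed disk `D̄(x₀,r)`,
one has `r · sup_{D̄(x₀,r)} ‖f'‖ ≥ (min_{1 ≤ ℓ ≤ d} ‖(ℓ : K)‖) · s`. -/
theorem mul_sSup_norm_deriv_ge_kappa
    {K : Type*} [NontriviallyNormedField K] [IsUltrametricDist K]
    [IsAlgClosed K] [CharZero K] [CompleteSpace K]
    (f : Polynomial K) (hf : 0 < f.natDegree) (x₀ : K) (r : ℝ) (hr : 0 < r)
    (s : ℝ) (hs : s = sSup ((fun z => ‖f.eval z - f.eval x₀‖) '' closedBall x₀ r)) :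
    r * sSup ((fun z => ‖(Polynomial.derivative f).eval z‖) '' closedBall x₀ r) ≥
      ((Finset.Icc 1 f.natDegree).inf' (Finset.nonempty_Icc.mpr hf)
        (fun ℓ => ‖(ℓ : K)‖)) * s := by
  set κ := (Finset.Icc 1 f.natDegree).inf' (Finset.nonempty_Icc.mpr hf) (fun ℓ => ‖(ℓ : K)‖)
    with hκ
  set M := sSup ((fun z => ‖(Polynomial.derivative f).eval z‖) '' closedBall x₀ r) with hMdef
  have hκ0 : 0 < κ := by
    rw [hκ, Finset.lt_inf'_iff]
    intro l hl
    have := (Finset.mem_Icc.mp hl).1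
    exact norm_pos_iff.mpr (Nat.cast_ne_zero.mpr (by omega))
  have hM : ∀ z, ‖z‖ ≤ r → ‖(derivative (taylor x₀ f)).eval z‖ ≤ M := by
    intro z hz
    have hd : (derivative (taylor x₀ f)).eval z = (derivative f).eval (z + x₀) := by
      simp [taylor_apply, derivative_comp]
    rw [hd]
    exact le_csSup (bddAbove_norm_eval_image_closedBall _ _ _)
      ⟨z + x₀, by simpa [mem_closedBall, dist_eq_norm] using hz, rfl⟩
  have hM0 : 0 ≤ M := (norm_nonneg _).trans (hM 0 (by simpa using hr.le))
  have hcoeff : ∀ i < f.natDegree, κ * (‖(taylor x₀ f).coeff (i + 1)‖ * r ^ (i + 1)) ≤ r * M := by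
    intro i hi
    have h := norm_coeff_mul_pow_le_of_forall_norm_eval_le _ hr hM i
    have hκi : κ ≤ ‖((i + 1 : ℕ) : K)‖ :=
      Finset.inf'_le _ (Finset.mem_Icc.mpr ⟨by omega, by omega⟩)
    rw [coeff_derivative, norm_mul, ← Nat.cast_add_one] at h
    calc κ * (‖(taylor x₀ f).coeff (i + 1)‖ * r ^ (i + 1))
        ≤ ‖((i + 1 : ℕ) : K)‖ * (‖(taylor x₀ f).coeff (i + 1)‖ * r ^ (i + 1)) := by gcongr
      _ = r * (‖(taylor x₀ f).coeff (i + 1)‖ * ‖((i + 1 : ℕ) : K)‖ * r ^ i) := by ring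
      _ ≤ r * M := by gcongr
  rw [ge_iff_le, mul_comm κ, ← le_div_iff₀ hκ0, hs]
  refine csSup_le ((nonempty_closedBall.mpr hr.le).image _) ?_
  rintro _ ⟨z, hz, rfl⟩
  have hz' : ‖z - x₀‖ ≤ r := by rwa [mem_closedBall, dist_eq_norm] at hz
  have hexp : f.eval z - f.eval x₀ =
      ∑ i ∈ Finset.range f.natDegree, (taylor x₀ f).coeff (i + 1) * (z - x₀) ^ (i + 1) := by
    have h : (taylor x₀ f).eval (z - x₀) = f.eval z := by simp [taylor_eval]
    rw [← h, eval_eq_sum_range, natDegree_taylor, Finset.sum_range_succ', taylor_coeff_zero]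
    simp
  dsimp only
  rw [hexp]
  refine IsUltrametricDist.norm_sum_le_of_forall_le_of_nonneg (by positivity) fun i hi => ?_
  rw [le_div_iff₀ hκ0, mul_comm, norm_mul, norm_pow]
  refine le_trans ?_ (hcoeff i (Finset.mem_range.mp hi))
  gcongr
end

section
/- Let f ∈ K[z] be a nonconstant polynomial, x₀ ∈ K, r > 0, and set s := sup_{z ∈ D̄(x₀,r)} ‖f(z) − f(x₀)‖. Then r · sup_{z ∈ D̄(x₀,r)} ‖f'(z)‖ ≤ s; that is, the sup-norm of f' on a closed disk never exceeds the ratio of the diameter of the image disk to the diameter of the disk. -/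
open Polynomial Metric

/-- In an ultrametric field, one of two consecutive natural numbers has norm one. -/
lemma norm_natCast_eq_one_or_norm_natCast_succ_eq_one
    {K : Type*} [NormedField K] [IsUltrametricDist K] (n : ℕ) :
    ‖(n : K)‖ = 1 ∨ ‖((n + 1 : ℕ) : K)‖ = 1 := by
  by_contra! h
  have h1 := lt_of_le_of_ne (IsUltrametricDist.norm_natCast_le_one K n) h.1
  have h2 := lt_of_le_of_ne (IsUltrametricDist.norm_natCast_le_one K (n + 1)) h.2
  have h3 : ‖((n + 1 : ℕ) : K) + -n‖ < 1 :=
    (IsUltrametricDist.norm_add_le_max _ _).trans_lt (max_lt h2 (by rwa [norm_neg]))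
  simp at h3

/-- Averaging the values of a polynomial over the `N`-th roots of unity extracts a coefficient. -/
lemma sum_inv_pow_mul_eval_eq_natCast_mul_coeff
    {K : Type*} [Field K] {N : ℕ} {ζ : K} (hζ : IsPrimitiveRoot ζ N)
    (p : Polynomial K) (hN : p.natDegree < N) {k : ℕ} (hk : k < N) (w : K) :
    ∑ j ∈ Finset.range N, ((ζ ^ k)⁻¹) ^ j * p.eval (ζ ^ j * w) = N * (p.coeff k * w ^ k) := by
  have hζ0 : ζ ≠ 0 := hζ.ne_zero (by omega)
  have key (i : ℕ) (hi : i < N) :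
      ∑ j ∈ Finset.range N, (ζ ^ i * (ζ ^ k)⁻¹) ^ j = if i = k then (N : K) else 0 := by
    split_ifs with h
    · subst h
      simp [hζ0]
    · have hne : ζ ^ i * (ζ ^ k)⁻¹ ≠ 1 := fun h1 =>
        h (hζ.pow_inj hi hk ((mul_inv_eq_one₀ (pow_ne_zero _ hζ0)).1 h1))
      have hone : (ζ ^ i * (ζ ^ k)⁻¹) ^ N = 1 := by
        rw [mul_pow, inv_pow, pow_right_comm, pow_right_comm ζ k, hζ.pow_eq_one]
        simp
      rw [geom_sum_eq hne, hone, sub_self, zero_div]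
  calc
    _ = ∑ j ∈ Finset.range N, ∑ i ∈ Finset.range N,
          p.coeff i * w ^ i * (ζ ^ i * (ζ ^ k)⁻¹) ^ j := by
      refine Finset.sum_congr rfl fun j _ => ?_
      rw [Polynomial.eval_eq_sum_range' hN, Finset.mul_sum]
      refine Finset.sum_congr rfl fun i _ => ?_
      rw [mul_pow, mul_pow, pow_right_comm ζ j i]
      ring
    _ = ∑ i ∈ Finset.range N, p.coeff i * w ^ i * if i = k then (N : K) else 0 := by
      rw [Finset.sum_comm]
      refine Finset.sum_congr rfl fun i hi => ?_
      rw [← Finset.mul_sum, key i (Finset.mem_range.1 hi)]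
    _ = _ := by
      simp [hk, mul_comm]

/-- Cauchy's estimate for the coefficients of a polynomial on an ultrametric circle. -/
lemma norm_coeff_mul_pow_le_of_forall_norm_eval_le_s10
    {K : Type*} [NormedField K] [IsUltrametricDist K] [IsAlgClosed K] [CharZero K]
    (p : Polynomial K) {w : K} {s : ℝ} (h : ∀ v : K, ‖v‖ = ‖w‖ → ‖p.eval v‖ ≤ s) (k : ℕ) :
    ‖p.coeff k‖ * ‖w‖ ^ k ≤ s := by
  have hs : 0 ≤ s := (norm_nonneg _).trans (h w rfl)
  obtain ⟨N, hpN, hkN, hN⟩ : ∃ N : ℕ, p.natDegree < N ∧ k < N ∧ ‖(N : K)‖ = 1 := by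
    rcases norm_natCast_eq_one_or_norm_natCast_succ_eq_one (K := K) (p.natDegree + k + 1)
      with h1 | h1
    · exact ⟨_, by omega, by omega, h1⟩
    · exact ⟨_, by omega, by omega, h1⟩
  have : NeZero (N : K) := ⟨fun h0 => by simp [h0] at hN⟩
  obtain ⟨ζ, hζ⟩ := HasEnoughRootsOfUnity.exists_primitiveRoot K N
  have hζ1 : ‖ζ‖ = 1 := (pow_eq_one_iff_of_nonneg (norm_nonneg ζ) (by lia : N ≠ 0)).1
    (by rw [← norm_pow, hζ.pow_eq_one, norm_one])
  have hsum := congrArg norm (sum_inv_pow_mul_eval_eq_natCast_mul_coeff hζ p hpN hkN w)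
  rw [norm_mul, hN, one_mul, norm_mul, norm_pow] at hsum
  rw [← hsum]
  refine IsUltrametricDist.norm_sum_le_of_forall_le_of_nonneg hs fun j _ => ?_
  simpa [hζ1] using h (ζ ^ j * w) (by simp [hζ1])

/-- Norms of an algebraically closed nontrivially normed field are dense in `(0, ∞)`. -/
lemma exists_norm_le_and_lt_mul_norm
    {K : Type*} [NontriviallyNormedField K] [IsAlgClosed K]
    {r c : ℝ} (hr : 0 < r) (hc : 1 < c) : ∃ w : K, ‖w‖ ≤ r ∧ r < c * ‖w‖ := by
  obtain ⟨a, ha⟩ := NormedField.exists_one_lt_norm K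
  obtain ⟨n, hn⟩ := pow_unbounded_of_one_lt ‖a‖ hc
  have hn0 : n ≠ 0 := by
    rintro rfl
    simp only [pow_zero] at hn
    linarith
  obtain ⟨b, hb⟩ := IsAlgClosed.exists_pow_nat_eq a (Nat.pos_of_ne_zero hn0)
  have hbn : ‖b‖ ^ n = ‖a‖ := by rw [← norm_pow, hb]
  have hb1 : 1 < ‖b‖ := (one_lt_pow_iff_of_nonneg (norm_nonneg _) hn0).1 (hbn ▸ ha)
  have hbc : ‖b‖ < c := lt_of_pow_lt_pow_left₀ n (by linarith) (hbn ▸ hn)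
  obtain ⟨m, hm1, hm2⟩ := exists_mem_Ico_zpow hr hb1
  refine ⟨b ^ m, by simpa using hm1, hm2.trans ?_⟩
  rw [zpow_add_one₀ (by linarith), mul_comm, norm_zpow]
  exact mul_lt_mul_of_pos_right hbc (zpow_pos (by linarith) m)

/-- A polynomial is bounded on every closed ball. -/
lemma exists_forall_mem_closedBall_norm_eval_le
    {K : Type*} [NormedField K] (p : Polynomial K) (x : K) (r : ℝ) :
    ∃ C : ℝ, ∀ z ∈ closedBall x r, ‖p.eval z‖ ≤ C := by
  refine ⟨∑ i ∈ Finset.range (p.natDegree + 1), ‖p.coeff i‖ * (‖x‖ + r) ^ i, fun z hz => ?_⟩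
  rw [Polynomial.eval_eq_sum_range]
  refine (norm_sum_le _ _).trans (Finset.sum_le_sum fun i _ => ?_)
  rw [norm_mul, norm_pow]
  have : ‖z‖ ≤ ‖x‖ + r := norm_le_of_mem_closedBall hz
  gcongr

/-- Distortion upper bound: for a nonconstant polynomial `f` over an algebraically closed,
complete nonarchimedean field, the sup-norm of `f'` on a closed disk never exceeds the
ratio of the diameter of the image disk to the diameter of the disk:
`r · sup_{D̄(x₀,r)} ‖f'‖ ≤ s` where `s = sup_{z ∈ D̄(x₀,r)} ‖f(z) − f(x₀)‖`. -/
theorem mul_sSup_norm_deriv_le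
    {K : Type*} [NontriviallyNormedField K] [IsUltrametricDist K]
    [IsAlgClosed K] [CharZero K] [CompleteSpace K]
    (f : Polynomial K) (hf : 0 < f.natDegree) (x₀ : K) (r : ℝ) (hr : 0 < r)
    (s : ℝ) (hs : s = sSup ((fun z => ‖f.eval z - f.eval x₀‖) '' closedBall x₀ r)) :
    r * sSup ((fun z => ‖(Polynomial.derivative f).eval z‖) '' closedBall x₀ r) ≤ s := by
  have hbdd : BddAbove ((fun z => ‖f.eval z - f.eval x₀‖) '' closedBall x₀ r) := by
    obtain ⟨C, hC⟩ := exists_forall_mem_closedBall_norm_eval_le (f - C (f.eval x₀)) x₀ r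
    refine ⟨C, ?_⟩
    rintro _ ⟨z, hz, rfl⟩
    simpa using hC z hz
  have hle (z : K) (hz : z ∈ closedBall x₀ r) : ‖f.eval z - f.eval x₀‖ ≤ s :=
    hs ▸ le_csSup hbdd ⟨z, hz, rfl⟩
  rw [← le_div_iff₀' hr]
  refine csSup_le ((nonempty_closedBall.2 hr.le).image _) ?_
  rintro _ ⟨z, hz, rfl⟩
  rw [le_div_iff₀' hr]
  have hcoeff (c : ℝ) (hc : 1 < c) : r * ‖(derivative f).eval z‖ ≤ c * s := by
    obtain ⟨w, hwr, hw⟩ := exists_norm_le_and_lt_mul_norm (K := K) hr hc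
    have hcauchy := norm_coeff_mul_pow_le_of_forall_norm_eval_le_s10
      (taylor z f - C (f.eval x₀)) (w := w) (s := s) (fun v hv => ?_) 1
    · rw [coeff_sub, taylor_coeff_one, coeff_C_of_ne_zero one_ne_zero, sub_zero, pow_one] at hcauchy
      calc
        r * ‖(derivative f).eval z‖ ≤ c * ‖w‖ * ‖(derivative f).eval z‖ := by gcongr
        _ = c * (‖(derivative f).eval z‖ * ‖w‖) := by ring
        _ ≤ c * s := by gcongr
    · rw [eval_sub, eval_C, taylor_eval]
      refine hle _ ?_
      rw [IsUltrametricDist.closedBall_eq_of_mem hz]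
      simpa [hv] using hwr
  rw [← one_mul s]
  refine le_mul_of_forall_lt₀ fun c hc t ht => (hcoeff c hc).trans ?_
  have : 0 ≤ c := zero_le_one.trans hc.le
  gcongr
end

section
/- Let f ∈ K[z] be a polynomial, x₀ ∈ K, R > 0, and set S := sup_{z ∈ D̄(x₀,R)} ‖f(z) − f(x₀)‖. Then f is Lipschitz on the closed disk D̄(x₀,R) with constant S/R: for all x, y ∈ D̄(x₀,R), ‖f(x) − f(y)‖ ≤ (S/R) · ‖x − y‖. Equivalently, for every a ∈ D̄(x₀,R) and every 0 < r ≤ R, the image f(D̄(a,r)) is contained in D̄(f(a), S·r/R). -/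
open Polynomial Metric

/-- The norm of an algebraically closed nontrivially normed field takes values in every
nonempty open interval of nonnegative reals. -/
theorem IsAlgClosed.exists_lt_norm_lt {K : Type*} [NontriviallyNormedField K] [IsAlgClosed K]
    {a b : ℝ} (ha : 0 ≤ a) (hab : a < b) : ∃ x : K, a < ‖x‖ ∧ ‖x‖ < b := by
  wlog hpos : 0 < a generalizing a
  · obtain ⟨x, hx, hxb⟩ := this (a := b / 2) (by linarith) (by linarith) (by linarith)
    exact ⟨x, by linarith, hxb⟩
  obtain ⟨c, hc⟩ := NormedField.exists_one_lt_norm K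
  obtain ⟨n, hn⟩ := pow_unbounded_of_one_lt ‖c‖ ((one_lt_div hpos).2 hab)
  have hn0 : n ≠ 0 := by
    rintro rfl
    rw [pow_zero] at hn
    exact hn.not_gt hc
  obtain ⟨d, hd⟩ := IsAlgClosed.exists_pow_nat_eq c (Nat.pos_of_ne_zero hn0)
  rw [← hd, norm_pow] at hc hn
  have hd1 : 1 < ‖d‖ := (one_lt_pow_iff_of_nonneg (norm_nonneg d) hn0).1 hc
  have hdb : ‖d‖ < b / a := lt_of_pow_lt_pow_left₀ n (div_nonneg (ha.trans hab.le) ha) hn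
  obtain ⟨m, hm, hm'⟩ := exists_mem_Ico_zpow hpos hd1
  refine ⟨d ^ (m + 1), by rwa [norm_zpow], ?_⟩
  calc ‖d ^ (m + 1)‖ = ‖d‖ ^ m * ‖d‖ := by
        rw [norm_zpow, zpow_add_one₀ (by linarith)]
    _ ≤ a * ‖d‖ := by gcongr
    _ < b := by rwa [lt_div_iff₀' hpos] at hdb

namespace Polynomial

/-- A split polynomial over an ultrametric field is at least as large at `w` as at any point `y`
not further than `w` from `a`, provided no root lies at distance exactly `‖w - a‖` from `a`. -/
theorem Splits.norm_eval_le_norm_eval {K : Type*} [NormedField K] [IsUltrametricDist K]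
    {h : K[X]} (hs : h.Splits) {a y w : K} (hyw : ‖y - a‖ ≤ ‖w - a‖)
    (hw : ∀ b ∈ h.roots, ‖w - a‖ ≠ ‖a - b‖) : ‖h.eval y‖ ≤ ‖h.eval w‖ := by
  have norm_prod (x : K) :
      ‖(h.roots.map (x - ·)).prod‖ = (h.roots.map fun b => ‖x - b‖).prod := by
    simpa [Multiset.map_map, Function.comp_def] using
      map_multiset_prod (normHom : K →*₀ ℝ) (h.roots.map (x - ·))
  rw [hs.eval_eq_prod_roots, hs.eval_eq_prod_roots, norm_mul, norm_mul, norm_prod, norm_prod]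
  gcongr
  refine Multiset.prod_map_le_prod_map₀ _ _ (fun _ _ => norm_nonneg _) fun b hb => ?_
  rw [IsUltrametricDist.norm_sub_eq_max_of_norm_sub_ne_norm_sub w a b (hw b hb)]
  calc ‖y - b‖ = ‖(y - a) + (a - b)‖ := by rw [sub_add_sub_cancel]
    _ ≤ max ‖y - a‖ ‖a - b‖ := IsUltrametricDist.norm_add_le_max _ _
    _ ≤ max ‖w - a‖ ‖a - b‖ := max_le_max_right _ hyw

open Filter Topology in
/-- A nonarchimedean Schwarz lemma for polynomials. -/
theorem norm_eval_sub_eval_le {K : Type*} [NontriviallyNormedField K] [IsUltrametricDist K]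
    [IsAlgClosed K] (f : K[X]) {a : K} {R S : ℝ} (hR : 0 < R)
    (hf : ∀ z ∈ closedBall a R, ‖f.eval z - f.eval a‖ ≤ S) {y : K} (hy : y ∈ closedBall a R) :
    ‖f.eval y - f.eval a‖ ≤ S / R * ‖y - a‖ := by
  have hya : ‖y - a‖ ≤ R := by rwa [← dist_eq_norm]
  rcases hya.eq_or_lt with heq | hlt
  · rw [heq, div_mul_cancel₀ _ hR.ne']
    exact hf y hy
  obtain ⟨h, hh⟩ := X_sub_C_dvd_sub_C_eval (p := f) (a := a)
  have hfac (z : K) : ‖f.eval z - f.eval a‖ = ‖h.eval z‖ * ‖z - a‖ := by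
    simpa [mul_comm] using congr(‖eval z $hh‖)
  rw [hfac]
  gcongr
  rw [le_div_iff₀ hR]
  by_contra! hcon
  have hfin : ((fun b => ‖a - b‖) '' {b | b ∈ h.roots}).Finite :=
    (Multiset.finite_toSet h.roots).image _
  have h1 : ∀ᶠ s in 𝓝[<] R, s ∉ (fun b => ‖a - b‖) '' {b | b ∈ h.roots} := by
    have := (hfin.subset Set.sdiff_subset).isClosed.compl_mem_nhds
      (x := R) (s := ((fun b => ‖a - b‖) '' {b | b ∈ h.roots}) \ {R}) (by simp)
    filter_upwards [nhdsWithin_le_nhds this, self_mem_nhdsWithin] with s hs hsR hmem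
    exact hs ⟨hmem, ne_of_lt hsR⟩
  have h2 : ∀ᶠ s in 𝓝[<] R, S < ‖h.eval y‖ * s :=
    nhdsWithin_le_nhds ((continuous_const_mul ‖h.eval y‖).continuousAt.eventually_const_lt hcon)
  obtain ⟨l, hl, hsub⟩ := mem_nhdsLT_iff_exists_Ioo_subset.1 (h1.and h2)
  obtain ⟨x, hx, hxR⟩ := IsAlgClosed.exists_lt_norm_lt (K := K)
    ((norm_nonneg _).trans (le_max_right l ‖y - a‖)) (max_lt hl hlt)
  obtain ⟨hxl, hxy⟩ := max_lt_iff.1 hx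
  obtain ⟨hroots, hS⟩ := hsub ⟨hxl, hxR⟩
  have hle : ‖h.eval y‖ ≤ ‖h.eval (a + x)‖ := by
    refine (IsAlgClosed.splits h).norm_eval_le_norm_eval (a := a) (by simpa using hxy.le) ?_
    intro b hb hbx
    exact hroots ⟨b, hb, by simpa using hbx.symm⟩
  have hSx : ‖h.eval (a + x)‖ * ‖x‖ ≤ S := by
    simpa [hfac] using hf (a + x) (by simpa using hxR.le)
  exact hS.not_ge ((mul_le_mul_of_nonneg_right hle (norm_nonneg x)).trans hSx)

/-- Polynomials are bounded on bounded sets. -/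
theorem exists_norm_eval_le {K : Type*} [NormedField K] (f : K[X]) (r : ℝ) :
    ∃ C, ∀ z : K, ‖z‖ ≤ r → ‖f.eval z‖ ≤ C := by
  refine ⟨∑ i ∈ Finset.range (f.natDegree + 1), ‖f.coeff i‖ * r ^ i, fun z hz => ?_⟩
  rw [eval_eq_sum_range]
  refine norm_sum_le_of_le _ fun i _ => ?_
  rw [norm_mul, norm_pow]
  gcongr

/-- The values of a polynomial on a closed ball are at bounded distance from the value at the
centre. -/
theorem bddAbove_norm_eval_sub_eval {K : Type*} [NormedField K] (f : K[X]) (x₀ : K) (R : ℝ) :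
    BddAbove ((fun z => ‖f.eval z - f.eval x₀‖) '' closedBall x₀ R) := by
  obtain ⟨C, hC⟩ := f.exists_norm_eval_le (‖x₀‖ + R)
  refine ⟨C + ‖f.eval x₀‖, ?_⟩
  rintro _ ⟨z, hz, rfl⟩
  exact (norm_sub_le _ _).trans (by gcongr; exact hC z (norm_le_of_mem_closedBall hz))

end Polynomial

/-- A polynomial over an algebraically closed, complete nonarchimedean field is Lipschitz on
a closed disk `D̄(x₀,R)` with constant `S/R`, where `S = sup_{z ∈ D̄(x₀,R)} ‖f(z) − f(x₀)‖`;
equivalently, for every `a` in the disk and `0 < r ≤ R`, `f(D̄(a,r)) ⊆ D̄(f(a), S·r/R)`. -/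
theorem lipschitzOn_closedBall
    {K : Type*} [NontriviallyNormedField K] [IsUltrametricDist K]
    [IsAlgClosed K] [CharZero K] [CompleteSpace K]
    (f : Polynomial K) (x₀ : K) (R : ℝ) (hR : 0 < R)
    (S : ℝ) (hS : S = sSup ((fun z => ‖f.eval z - f.eval x₀‖) '' closedBall x₀ R)) :
    (∀ x ∈ closedBall x₀ R, ∀ y ∈ closedBall x₀ R,
        ‖f.eval x - f.eval y‖ ≤ (S / R) * ‖x - y‖) ∧
      (∀ a ∈ closedBall x₀ R, ∀ r : ℝ, 0 < r → r ≤ R →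
        (fun z => f.eval z) '' closedBall a r ⊆ closedBall (f.eval a) (S * r / R)) := by
  have lip : ∀ x ∈ closedBall x₀ R, ∀ y ∈ closedBall x₀ R,
      ‖f.eval x - f.eval y‖ ≤ (S / R) * ‖x - y‖ := by
    intro x hx y hy
    have hsup : ∀ z ∈ closedBall x₀ R, ‖f.eval z - f.eval x₀‖ ≤ S := fun z hz =>
      hS ▸ le_csSup (f.bddAbove_norm_eval_sub_eval x₀ R) ⟨z, hz, rfl⟩
    have hball : closedBall y R = closedBall x₀ R :=
      (IsUltrametricDist.closedBall_eq_of_mem hy).symm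
    refine f.norm_eval_sub_eval_le hR (fun z hz => ?_) (hball ▸ hx)
    rw [← sub_add_sub_cancel _ (f.eval x₀)]
    exact (IsUltrametricDist.norm_add_le_max _ _).trans
      (max_le (hsup z (hball ▸ hz)) (norm_sub_rev (f.eval y) _ ▸ hsup y hy))
  refine ⟨lip, fun a ha r _ hrR => ?_⟩
  rintro _ ⟨z, hz, rfl⟩
  have hS0 : 0 ≤ S := hS ▸ Real.sSup_nonneg (by rintro _ ⟨z, -, rfl⟩; exact norm_nonneg _)
  have hzx : z ∈ closedBall x₀ R :=
    IsUltrametricDist.closedBall_eq_of_mem ha ▸ closedBall_subset_closedBall hrR hz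
  rw [mem_closedBall, dist_eq_norm] at hz ⊢
  calc ‖f.eval z - f.eval a‖ ≤ S / R * ‖z - a‖ := lip z hzx a ha
    _ ≤ S / R * r := by gcongr
    _ = S * r / R := div_mul_eq_mul_div _ _ _
end

section
/- Let f ∈ K[z] be a nonconstant polynomial, a ∈ K, and 0 < r₁ < r₂. Then sup_{z ∈ D̄(a,r₁)} ‖f(z) − f(a)‖ < sup_{z ∈ D̄(a,r₂)} ‖f(z) − f(a)‖; that is, the radius of the image disk f(D̄(a,r)) is strictly increasing as a function of r. (This is the fact that a polynomial maps strictly nested disks to strictly nested disks, underlying Lemma on sup-norm monotonicity.) -/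
open Polynomial Metric

/-- The value group of an algebraically closed valued field is dense in the positive reals. -/
theorem IsAlgClosed.exists_norm_mem_Ioo {K : Type*} [NontriviallyNormedField K] [IsAlgClosed K]
    {r s : ℝ} (hr : 0 < r) (hrs : r < s) : ∃ z : K, ‖z‖ ∈ Set.Ioo r s := by
  obtain ⟨c, hc⟩ := NormedField.exists_one_lt_norm K
  have hq : 1 < s / r := (one_lt_div hr).2 hrs
  obtain ⟨n, hn⟩ := pow_unbounded_of_one_lt ‖c‖ hq
  have hn0 : n ≠ 0 := by
    rintro rfl
    rw [pow_zero] at hn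
    exact lt_asymm hc hn
  obtain ⟨d, hd⟩ := IsAlgClosed.exists_pow_nat_eq c (Nat.pos_of_ne_zero hn0)
  rw [← hd, norm_pow] at hc hn
  have hd1 : 1 < ‖d‖ := (one_lt_pow_iff_of_nonneg (norm_nonneg d) hn0).1 hc
  have hds : ‖d‖ < s / r := lt_of_pow_lt_pow_left₀ n (by positivity) hn
  obtain ⟨m, hm₁, hm₂⟩ := exists_mem_Ico_zpow hr hd1
  refine ⟨d ^ (m + 1), ?_, ?_⟩
  · rwa [norm_zpow]
  · rw [norm_zpow, zpow_add_one₀ (by positivity)]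
    calc ‖d‖ ^ m * ‖d‖ ≤ r * ‖d‖ := by gcongr
      _ < r * (s / r) := by gcongr
      _ = s := by field_simp

/-- The value group of an algebraically closed valued field meets every open interval of
positive reals outside any given finite set. -/
theorem IsAlgClosed.exists_norm_mem_Ioo_notMem {K : Type*} [NontriviallyNormedField K]
    [IsAlgClosed K] {r s : ℝ} (hr : 0 < r) (hrs : r < s) {S : Set ℝ} (hS : S.Finite) :
    ∃ z : K, ‖z‖ ∈ Set.Ioo r s ∧ ‖z‖ ∉ S := by
  have hfin : (S \ {r})ᶜ ∈ nhds r := (hS.subset Set.sdiff_subset).isClosed.compl_mem_nhds (by simp)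
  obtain ⟨u, hu, hsub⟩ := (mem_nhdsGT_iff_exists_Ioo_subset' hrs).1
    (mem_nhdsWithin_of_mem_nhds hfin)
  obtain ⟨z, hz₁, hz₂⟩ := exists_norm_mem_Ioo (K := K) hr (lt_min hrs hu)
  refine ⟨z, ⟨hz₁, hz₂.trans_le (min_le_left _ _)⟩, fun hzS => ?_⟩
  exact hsub ⟨hz₁, hz₂.trans_le (min_le_right _ _)⟩ ⟨hzS, hz₁.ne'⟩

/-- Over an algebraically closed normed field, the norm of a polynomial value is the norm of the
leading coefficient times the product of the distances to the roots. -/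
theorem Polynomial.norm_eval_eq_prod_roots {K : Type*} [NormedField K] [IsAlgClosed K]
    (p : K[X]) (z : K) :
    ‖p.eval z‖ = ‖p.leadingCoeff‖ * (p.roots.map fun α => ‖z - α‖).prod := by
  conv_lhs => rw [(IsAlgClosed.splits p).eval_eq_prod_roots z]
  rw [norm_mul, ← normHom_apply (Multiset.prod _), map_multiset_prod, Multiset.map_map]
  rfl

/-- A nonconstant polynomial over an algebraically closed, complete nonarchimedean field
maps strictly nested disks to strictly nested disks: the radius of the image disk
`sup_{z ∈ D̄(a,r)} ‖f(z) − f(a)‖` is strictly increasing in `r`. -/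
theorem sSup_image_strictMono
    {K : Type*} [NontriviallyNormedField K] [IsUltrametricDist K]
    [IsAlgClosed K] [CharZero K] [CompleteSpace K]
    (f : Polynomial K) (hf : 0 < f.natDegree) (a : K) (r₁ r₂ : ℝ)
    (hr₁ : 0 < r₁) (hr₁₂ : r₁ < r₂) :
    sSup ((fun z => ‖f.eval z - f.eval a‖) '' closedBall a r₁) <
      sSup ((fun z => ‖f.eval z - f.eval a‖) '' closedBall a r₂) := by
  set h : K[X] := f - C (f.eval a) with hdef
  have heval : ∀ z, f.eval z - f.eval a = h.eval z := by simp [hdef]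
  simp only [heval]
  have hdeg : h.natDegree = f.natDegree := natDegree_sub_C
  have h0 : h ≠ 0 := ne_zero_of_natDegree_gt (hdeg ▸ hf)
  have hroot : a ∈ h.roots := (mem_roots h0).2 (by simp [hdef])
  have hlead : 0 < ‖h.leadingCoeff‖ := norm_pos_iff.2 (leadingCoeff_ne_zero.2 h0)
  let M : ℝ → ℝ := fun r => ‖h.leadingCoeff‖ * (h.roots.map fun α => max r ‖a - α‖).prod
  have hsub : ∀ z α : K, z - α = (z - a) + (a - α) := fun z α => by ring
  have hle : ∀ r, ∀ z ∈ closedBall a r, ‖h.eval z‖ ≤ M r := by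
    intro r z hz
    rw [mem_closedBall_iff_norm] at hz
    rw [h.norm_eval_eq_prod_roots]
    refine mul_le_mul_of_nonneg_left (Multiset.prod_map_le_prod_map₀ _ _
      (fun _ _ => norm_nonneg _) fun α _ => ?_) hlead.le
    rw [hsub]
    exact (IsUltrametricDist.norm_add_le_max _ _).trans (max_le_max_right _ hz)
  obtain ⟨w, ⟨hw₁, hw₂⟩, hwS⟩ := IsAlgClosed.exists_norm_mem_Ioo_notMem (K := K) hr₁ hr₁₂
    ((Multiset.finite_toSet h.roots).image fun α => ‖a - α‖)
  have hw : ‖h.eval (a + w)‖ = M ‖w‖ := by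
    rw [h.norm_eval_eq_prod_roots]
    congr 2
    refine Multiset.map_congr rfl fun α hα => ?_
    have hne : ‖w‖ ≠ ‖a - α‖ := fun e => hwS ⟨α, hα, e.symm⟩
    rw [hsub, add_sub_cancel_left]
    exact IsUltrametricDist.norm_add_eq_max_of_norm_ne_norm hne
  have hM : M r₁ < M ‖w‖ := by
    obtain ⟨t, ht⟩ := Multiset.exists_cons_of_mem hroot
    refine mul_lt_mul_of_pos_left ?_ hlead
    simp only [ht, Multiset.map_cons, Multiset.prod_cons, sub_self, norm_zero,
      max_eq_left hr₁.le, max_eq_left (norm_nonneg w)]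
    refine mul_lt_mul hw₁ (Multiset.prod_map_le_prod_map₀ _ _
      (fun _ _ => hr₁.le.trans (le_max_left _ _)) fun α _ => max_le_max_right _ hw₁.le)
      (Multiset.prod_pos ?_) (norm_nonneg w)
    simp only [Multiset.mem_map]
    rintro _ ⟨α, -, rfl⟩
    exact hr₁.trans_le (le_max_left _ _)
  calc sSup ((fun z => ‖h.eval z‖) '' closedBall a r₁) ≤ M r₁ :=
        csSup_le ((nonempty_closedBall.2 hr₁.le).image _) (Set.forall_mem_image.2 (hle r₁))
    _ < M ‖w‖ := hM
    _ = ‖h.eval (a + w)‖ := hw.symm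
    _ ≤ sSup ((fun z => ‖h.eval z‖) '' closedBall a r₂) :=
        le_csSup ⟨M r₂, Set.forall_mem_image.2 (hle r₂)⟩
          ⟨a + w, by simpa using hw₂.le, rfl⟩
end

section
/- Let f ∈ K[z] be a nonconstant polynomial, x₀ ∈ K, r > 0, and set s := sup_{z ∈ D̄(x₀,r)} ‖f(z) − f(x₀)‖. For w ∈ K let N(w) denote the number of solutions of f(z) = w in D̄(x₀,r), counted with multiplicity. Then N is constant on the image disk: N(w₁) = N(w₂) for all w₁, w₂ ∈ D̄(f(x₀), s). (Every point of the image disk has the same number of preimages in the disk, counted with multiplicity; this common value is the local degree of f on the disk.) -/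
open Polynomial Metric
open scoped Classical

/-- The norm of an algebraically closed nontrivially normed field takes a value between any two
positive reals. -/
theorem IsAlgClosed.exists_norm_mem_Ioo_s15 {K : Type*} [NontriviallyNormedField K] [IsAlgClosed K]
    {a b : ℝ} (ha : 0 < a) (hab : a < b) : ∃ z : K, a < ‖z‖ ∧ ‖z‖ < b := by
  obtain ⟨c, hc⟩ := NormedField.exists_one_lt_norm K
  have hba : 1 < b / a := (one_lt_div ha).2 hab
  obtain ⟨n, hn⟩ := pow_unbounded_of_one_lt ‖c‖ hba
  have hn0 : n ≠ 0 := by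
    rintro rfl
    rw [pow_zero] at hn
    linarith
  obtain ⟨y, rfl⟩ := IsAlgClosed.exists_pow_nat_eq c (Nat.pos_of_ne_zero hn0)
  rw [norm_pow] at hc hn
  have hy : 1 < ‖y‖ := (one_lt_pow_iff_of_nonneg (norm_nonneg y) hn0).1 hc
  have hyb : ‖y‖ < b / a := lt_of_pow_lt_pow_left₀ n (by positivity) hn
  obtain ⟨m, hm₁, hm₂⟩ := exists_mem_Ico_zpow ha hy
  refine ⟨y ^ (m + 1), by rwa [norm_zpow], ?_⟩
  rw [norm_zpow, zpow_add_one₀ (by positivity)]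
  calc ‖y‖ ^ m * ‖y‖ ≤ a * ‖y‖ := by gcongr
    _ < a * (b / a) := by gcongr
    _ = b := by field_simp

/-- Just outside a closed disk, a product of linear factors has the absolute value of a monomial
whose exponent counts the factors vanishing in the disk; inside the disk, the value of that
monomial at the radius is an upper bound. -/
theorem Multiset.exists_prod_norm_sub_eq_mul_pow {K : Type*} [NormedField K] [IsUltrametricDist K]
    (x₀ : K) {r : ℝ} (hr : 0 < r) (m : Multiset K) :
    ∃ C > 0, ∃ R > r,
      (∀ z ∈ closedBall x₀ r,
        (m.map fun a => ‖z - a‖).prod ≤ C * r ^ (m.filter (· ∈ closedBall x₀ r)).card) ∧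
      ∀ z, r < ‖z - x₀‖ → ‖z - x₀‖ < R →
        (m.map fun a => ‖z - a‖).prod =
          C * ‖z - x₀‖ ^ (m.filter (· ∈ closedBall x₀ r)).card := by
  induction m using Multiset.induction with
  | empty => exact ⟨1, one_pos, r + 1, by simp, by simp, by simp⟩
  | cons a m ih =>
    obtain ⟨C, hC, R, hR, hin, hout⟩ := ih
    have key : ∀ z : K, z - a = (z - x₀) + (x₀ - a) := fun z => by ring
    by_cases ha : a ∈ closedBall x₀ r
    · have ha' : ‖x₀ - a‖ ≤ r := by rwa [mem_closedBall, dist_comm, dist_eq_norm] at ha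
      refine ⟨C, hC, R, hR, fun z hz => ?_, fun z hz hzR => ?_⟩
      · rw [mem_closedBall, dist_eq_norm] at hz
        have hza : ‖z - a‖ ≤ r := by
          rw [key]
          exact (IsUltrametricDist.norm_add_le_max _ _).trans (max_le hz ha')
        have := hin z (by rwa [mem_closedBall, dist_eq_norm])
        rw [Multiset.map_cons, Multiset.prod_cons, Multiset.filter_cons_of_pos _ ha,
          Multiset.card_cons, pow_succ', mul_left_comm]
        exact mul_le_mul hza this (Multiset.prod_map_nonneg fun _ _ => norm_nonneg _) hr.le
      · have hza : ‖z - a‖ = ‖z - x₀‖ := by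
          rw [key, IsUltrametricDist.norm_add_eq_max_of_norm_ne_norm (by linarith),
            max_eq_left (by linarith)]
        rw [Multiset.map_cons, Multiset.prod_cons, Multiset.filter_cons_of_pos _ ha,
          Multiset.card_cons, pow_succ', hza, hout z hz hzR]
        ring
    · have ha' : r < ‖x₀ - a‖ := by
        rwa [mem_closedBall, dist_comm, dist_eq_norm, not_le] at ha
      have hza : ∀ z, ‖z - x₀‖ < ‖x₀ - a‖ → ‖z - a‖ = ‖x₀ - a‖ := fun z hz => by
        rw [key, IsUltrametricDist.norm_add_eq_max_of_norm_ne_norm hz.ne, max_eq_right hz.le]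
      refine ⟨‖x₀ - a‖ * C, mul_pos (hr.trans ha') hC, min R ‖x₀ - a‖, lt_min hR ha',
        fun z hz => ?_, fun z hz hzR => ?_⟩
      · rw [Multiset.map_cons, Multiset.prod_cons, Multiset.filter_cons_of_neg _ ha,
          hza z ((by rwa [mem_closedBall, dist_eq_norm] at hz : _ ≤ r).trans_lt ha'), mul_assoc]
        gcongr
        exact hin z hz
      · rw [Multiset.map_cons, Multiset.prod_cons, Multiset.filter_cons_of_neg _ ha,
          hza z (hzR.trans_le (min_le_right _ _)), mul_assoc,
          hout z hz (hzR.trans_le (min_le_left _ _))]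

/-- Just outside a closed disk, a nonzero polynomial has the absolute value of a monomial whose
exponent is the number of roots in the disk; inside the disk, the value of that monomial at the
radius is an upper bound. -/
theorem Polynomial.exists_norm_eval_eq_mul_pow {K : Type*} [NormedField K] [IsUltrametricDist K]
    [IsAlgClosed K] (x₀ : K) {r : ℝ} (hr : 0 < r) {p : K[X]} (hp : p ≠ 0) :
    ∃ C > 0, ∃ R > r,
      (∀ z ∈ closedBall x₀ r,
        ‖p.eval z‖ ≤ C * r ^ (p.roots.filter (· ∈ closedBall x₀ r)).card) ∧
      ∀ z, r < ‖z - x₀‖ → ‖z - x₀‖ < R →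
        ‖p.eval z‖ = C * ‖z - x₀‖ ^ (p.roots.filter (· ∈ closedBall x₀ r)).card := by
  obtain ⟨C, hC, R, hR, hin, hout⟩ := p.roots.exists_prod_norm_sub_eq_mul_pow x₀ hr
  have hev : ∀ z, ‖p.eval z‖ = ‖p.leadingCoeff‖ * (p.roots.map fun a => ‖z - a‖).prod := by
    intro z
    rw [(IsAlgClosed.splits p).eval_eq_prod_roots, norm_mul]
    congr 1
    simpa using map_multiset_prod (normHom : K →*₀ ℝ) (p.roots.map fun a => z - a)
  refine ⟨‖p.leadingCoeff‖ * C, mul_pos (by simpa using hp) hC, R, hR, fun z hz => ?_,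
    fun z hz hzR => ?_⟩
  · rw [hev, mul_assoc]
    gcongr
    exact hin z hz
  · rw [hev, mul_assoc, hout z hz hzR]

/-- A monomial function with positive coefficient is determined by its values at two distinct
positive points, in particular so is its exponent. -/
theorem exponent_eq_of_mul_pow_eq {C D x y : ℝ} {m n : ℕ} (hC : 0 < C) (hx : 0 < x) (hxy : x < y)
    (h₁ : C * x ^ m = D * x ^ n) (h₂ : C * y ^ m = D * y ^ n) : m = n := by
  have hD : 0 < D := by
    have : 0 < D * x ^ n := h₁ ▸ by positivity
    exact pos_of_mul_pos_left this (by positivity)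
  have hy : 0 < y := hx.trans hxy
  have h : (y / x) ^ m = (y / x) ^ n := by
    have h₃ : (C * y ^ m) / (C * x ^ m) = (D * y ^ n) / (D * x ^ n) := by rw [h₁, h₂]
    rwa [mul_div_mul_left _ _ hC.ne', mul_div_mul_left _ _ hD.ne', ← div_pow, ← div_pow] at h₃
  exact pow_right_injective₀ (by positivity) ((one_lt_div hx).2 hxy).ne' h

/-- Every point of the image disk has the same number of preimages in the disk, counted with
multiplicity: for a nonconstant polynomial `f` over an algebraically closed, complete
nonarchimedean field, `s = sup_{z ∈ D̄(x₀,r)} ‖f(z) − f(x₀)‖`, and `N w` the number of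
solutions of `f(z) = w` in `D̄(x₀,r)` counted with multiplicity, `N` is constant on
`D̄(f(x₀), s)`. -/
theorem card_roots_in_closedBall_const
    {K : Type*} [NontriviallyNormedField K] [IsAlgClosed K] [IsUltrametricDist K]
    [CharZero K] [CompleteSpace K]
    (f : Polynomial K) (hf : 0 < f.natDegree) (x₀ : K) (r : ℝ) (hr : 0 < r)
    (s : ℝ) (hs : s = sSup ((fun z => ‖f.eval z - f.eval x₀‖) '' closedBall x₀ r))
    (N : K → ℕ)
    (hN : ∀ w : K, N w = Multiset.card
      (((f - Polynomial.C w).roots).filter (· ∈ closedBall x₀ r))) :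
    ∀ w₁ ∈ closedBall (f.eval x₀) s, ∀ w₂ ∈ closedBall (f.eval x₀) s, N w₁ = N w₂ := by
  have hne : ∀ w, f - C w ≠ 0 := fun w h => by
    have := natDegree_sub_C (p := f) (a := w)
    rw [h, natDegree_zero] at this
    omega
  suffices h : ∀ w ∈ closedBall (f.eval x₀) s, N (f.eval x₀) = N w from
    fun w₁ h₁ w₂ h₂ => (h w₁ h₁).symm.trans (h w₂ h₂)
  intro w hw
  rw [mem_closedBall, dist_eq_norm] at hw
  obtain ⟨C₀, hC₀, R₀, hR₀, hin, hout₀⟩ := exists_norm_eval_eq_mul_pow x₀ hr (hne (f.eval x₀))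
  obtain ⟨C₁, -, R₁, hR₁, -, hout₁⟩ := exists_norm_eval_eq_mul_pow x₀ hr (hne w)
  rw [← hN] at hin hout₀ hout₁
  simp only [eval_sub, eval_C] at hin hout₀ hout₁
  have hN₀ : N (f.eval x₀) ≠ 0 := by
    rw [hN]
    refine (Multiset.card_pos_iff_exists_mem.2 ⟨x₀, ?_⟩).ne'
    simp [hne, hr.le]
  have hs' : s ≤ C₀ * r ^ N (f.eval x₀) := by
    rw [hs]
    refine csSup_le ((nonempty_closedBall.2 hr.le).image _) ?_
    rintro _ ⟨z, hz, rfl⟩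
    exact hin z hz
  have heq : ∀ z, r < ‖z - x₀‖ → ‖z - x₀‖ < min R₀ R₁ →
      C₀ * ‖z - x₀‖ ^ N (f.eval x₀) = C₁ * ‖z - x₀‖ ^ N w := by
    intro z hz hzR
    rw [← hout₀ z hz (hzR.trans_le (min_le_left _ _)),
      ← hout₁ z hz (hzR.trans_le (min_le_right _ _))]
    have hlt : ‖f.eval x₀ - w‖ < ‖f.eval z - f.eval x₀‖ := by
      rw [norm_sub_rev, hout₀ z hz (hzR.trans_le (min_le_left _ _))]
      refine (hw.trans hs').trans_lt ?_
      gcongr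
    rw [← sub_add_sub_cancel (f.eval z) (f.eval x₀) w,
      IsUltrametricDist.norm_add_eq_max_of_norm_ne_norm hlt.ne', max_eq_left hlt.le]
  obtain ⟨a, ha, haR⟩ := IsAlgClosed.exists_norm_mem_Ioo_s15 (K := K) hr (lt_min hR₀ hR₁)
  obtain ⟨b, hb, hbR⟩ := IsAlgClosed.exists_norm_mem_Ioo_s15 (K := K) (hr.trans ha) haR
  refine exponent_eq_of_mul_pow_eq (D := C₁) hC₀ (hr.trans ha) hb ?_ ?_
  · simpa using heq (x₀ + a) (by simpa using ha) (by simpa using haR)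
  · simpa using heq (x₀ + b) (by simpa using ha.trans hb) (by simpa using hbR)
end

section
/- Let f ∈ K[z] be a polynomial and let x ∈ K be a point whose forward orbit is bounded, i.e. there is R > 0 with ‖f^k(x)‖ ≤ R for all k ≥ 0, and suppose f'(f^k(x)) ≠ 0 for all k ≥ 0. Then (1/n) · Σ_{k=0}^{n-1} ( log f^#(f^k(x)) − log ‖f'(f^k(x))‖ ) tends to 0 as n → ∞; consequently, liminf_{n→∞} (1/n) Σ_{k=0}^{n-1} log f^#(f^k(x)) = liminf_{n→∞} (1/n) Σ_{k=0}^{n-1} log ‖f'(f^k(x))‖, i.e. the lower Lyapunov exponent of f at x computed with the chordal derivative coincides with the one computed with the usual derivative. -/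
open Polynomial Metric Filter

/-- The chordal derivative `g^#(z) = (max(1,‖z‖)² / max(1,‖g(z)‖)²) · ‖g'(z)‖` of a
polynomial `g` at a point `z`. -/
noncomputable def chordalDeriv {K : Type*} [NormedField K] (g : Polynomial K) (z : K) : ℝ :=
  (max 1 ‖z‖) ^ 2 / (max 1 ‖g.eval z‖) ^ 2 * ‖(Polynomial.derivative g).eval z‖

theorem sSup_le_sSup_of_forall_sub_mem {S T : Set ℝ}
    (hST : ∀ ε > 0, ∀ a ∈ S, a - ε ∈ T) (hS : S.Nonempty) (hT : BddAbove T) :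
    sSup S ≤ sSup T := by
  refine csSup_le hS fun a ha => le_of_forall_pos_le_add fun ε hε => ?_
  linarith [le_csSup hT (hST ε hε a ha)]

theorem BddAbove.of_forall_sub_mem {S T : Set ℝ}
    (hST : ∀ ε > 0, ∀ a ∈ S, a - ε ∈ T) (hT : BddAbove T) : BddAbove S := by
  obtain ⟨b, hb⟩ := hT
  exact ⟨b + 1, fun a ha => by linarith [hb (hST 1 one_pos a ha)]⟩

theorem sSup_eq_sSup_of_forall_sub_mem {S T : Set ℝ}
    (hST : ∀ ε > 0, ∀ a ∈ S, a - ε ∈ T) (hTS : ∀ ε > 0, ∀ a ∈ T, a - ε ∈ S) :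
    sSup S = sSup T := by
  rcases S.eq_empty_or_nonempty with rfl | hS
  · rcases T.eq_empty_or_nonempty with rfl | ⟨a, ha⟩
    · rfl
    · exact (hTS 1 one_pos a ha).elim
  · have hT : T.Nonempty := hS.elim fun a ha => ⟨_, hST 1 one_pos a ha⟩
    by_cases hb : BddAbove T
    · exact le_antisymm (sSup_le_sSup_of_forall_sub_mem hST hS hb)
        (sSup_le_sSup_of_forall_sub_mem hTS hT (.of_forall_sub_mem hST hb))
    · rw [Real.sSup_of_not_bddAbove hb,
        Real.sSup_of_not_bddAbove fun h => hb (.of_forall_sub_mem hTS h)]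

/-- Real functions whose difference tends to `0` have the same `liminf`; no boundedness is
needed, since the default value `0` is then attained on both sides. -/
theorem liminf_eq_liminf_of_tendsto_sub {α : Type*} {l : Filter α} {u v : α → ℝ}
    (h : Tendsto (fun n => u n - v n) l (nhds 0)) : liminf u l = liminf v l := by
  rw [liminf_eq, liminf_eq]
  refine sSup_eq_sSup_of_forall_sub_mem (fun ε hε a ha => ?_) fun ε hε a ha => ?_
  · filter_upwards [ha, h.eventually_lt_const hε] with n h₁ h₂
    linarith
  · filter_upwards [ha, h.eventually_const_lt (neg_lt_zero.mpr hε)] with n h₁ h₂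
    linarith

theorem log_chordalDeriv_sub_log {K : Type*} [NormedField K] (f : Polynomial K) {z : K}
    (hz : (Polynomial.derivative f).eval z ≠ 0) :
    Real.log (chordalDeriv f z) - Real.log ‖(Polynomial.derivative f).eval z‖ =
      2 * Real.log (max 1 ‖z‖) - 2 * Real.log (max 1 ‖f.eval z‖) := by
  have hpos (w : K) : (max 1 ‖w‖) ^ 2 ≠ 0 := by positivity
  rw [chordalDeriv, Real.log_mul (div_ne_zero (hpos _) (hpos _)) (norm_ne_zero_iff.mpr hz),
    Real.log_div (hpos _) (hpos _), Real.log_pow, Real.log_pow]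
  push_cast
  ring

/-- For a point `x` with bounded forward orbit under a polynomial `f` avoiding the critical
points of `f`, the Birkhoff averages of `log f^#` and of `log ‖f'‖` along the orbit differ
by `o(1)`; consequently the lower Lyapunov exponent computed with the chordal derivative
coincides with the one computed with the usual derivative. -/
theorem liminf_chordal_eq_liminf_deriv
    {K : Type*} [NontriviallyNormedField K] [IsUltrametricDist K]
    [IsAlgClosed K] [CharZero K] [CompleteSpace K]
    (f : Polynomial K) (x : K) (R : ℝ) (hR : 0 < R)
    (hbound : ∀ k : ℕ, ‖(fun z => f.eval z)^[k] x‖ ≤ R)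
    (hcrit : ∀ k : ℕ, (Polynomial.derivative f).eval ((fun z => f.eval z)^[k] x) ≠ 0) :
    Tendsto (fun n : ℕ => (1 / (n : ℝ)) * ∑ k ∈ Finset.range n,
        (Real.log (chordalDeriv f ((fun z => f.eval z)^[k] x)) -
          Real.log ‖(Polynomial.derivative f).eval ((fun z => f.eval z)^[k] x)‖))
      atTop (nhds 0) ∧
      liminf (fun n : ℕ => (1 / (n : ℝ)) * ∑ k ∈ Finset.range n,
          Real.log (chordalDeriv f ((fun z => f.eval z)^[k] x))) atTop =
        liminf (fun n : ℕ => (1 / (n : ℝ)) * ∑ k ∈ Finset.range n,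
          Real.log ‖(Polynomial.derivative f).eval ((fun z => f.eval z)^[k] x)‖) atTop := by
  have hsum (n : ℕ) : ∑ k ∈ Finset.range n,
      (Real.log (chordalDeriv f ((fun z => f.eval z)^[k] x)) -
        Real.log ‖(Polynomial.derivative f).eval ((fun z => f.eval z)^[k] x)‖) =
      2 * Real.log (max 1 ‖x‖) - 2 * Real.log (max 1 ‖(fun z => f.eval z)^[n] x‖) := by
    rw [Finset.sum_congr rfl fun k _ => log_chordalDeriv_sub_log f (hcrit k)]
    simp only [← Function.iterate_succ_apply' (fun z => f.eval z)]
    exact Finset.sum_range_sub'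
      (fun k => 2 * Real.log (max 1 ‖(fun z => f.eval z)^[k] x‖)) n
  have hlog (k : ℕ) : 0 ≤ Real.log (max 1 ‖(fun z => f.eval z)^[k] x‖) ∧
      Real.log (max 1 ‖(fun z => f.eval z)^[k] x‖) ≤ Real.log (max 1 R) :=
    ⟨Real.log_nonneg (le_max_left _ _),
      Real.log_le_log (by positivity) (max_le_max le_rfl (hbound k))⟩
  have hlim : Tendsto (fun n : ℕ => (1 / (n : ℝ)) * ∑ k ∈ Finset.range n,
      (Real.log (chordalDeriv f ((fun z => f.eval z)^[k] x)) -
        Real.log ‖(Polynomial.derivative f).eval ((fun z => f.eval z)^[k] x)‖))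
      atTop (nhds 0) := by
    simp only [hsum]
    refine tendsto_one_div_atTop_nhds_zero_nat.zero_mul_isBoundedUnder_le
      (isBoundedUnder_of ⟨2 * Real.log (max 1 R), fun n => ?_⟩)
    have h₀ := hlog 0
    rw [Function.iterate_zero_apply] at h₀
    simp only [Function.comp_apply, Real.norm_eq_abs, abs_le]
    constructor <;> linarith [h₀.1, h₀.2, (hlog n).1, (hlog n).2]
  refine ⟨hlim, liminf_eq_liminf_of_tendsto_sub ?_⟩
  simpa only [Finset.sum_sub_distrib, mul_sub] using hlim
end
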